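/- Let W be a d-dimensional fractional Brownian motion with Hurst parameter H ∈ (0,1) and continuous sample paths. For every α > −1/(2H) there exists γ > 1/2 such that almost surely the averaging constant of the sample path is finite: K^W_{α,γ} < ∞. -/

import Mathlib

open MeasureTheory Filter Topology
open scoped ENNReal NNReal

noncomputable section

abbrev Euc (d : ℕ) : Type := EuclideanSpace ℝ (Fin d)

/-- `Y^w_{s,t}(ω,ξ) = ∫_s^t exp(i ξ·w_u + i ω u) du`. -/
def Yint {d : ℕ} (w : ℝ → Euc d) (s t ω : ℝ) (ξ : Euc d) : ℂ :=
  ∫ u in s..t, Complex.exp (Complex.I * Complex.ofReal (inner ℝ ξ (w u) + ω * u))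

/-- The averaging constant `K^w_{α,γ}`. -/
def avgK {d : ℕ} (w : ℝ → Euc d) (α γ : ℝ) : ℝ≥0∞ :=
  ⨆ (s : ℝ) (t : ℝ) (_ : 0 ≤ s) (_ : s < t) (_ : t ≤ 1) (ω : ℝ) (ξ : Euc d),
    ENNReal.ofReal (‖Yint w s t ω ξ‖ /
      ((1 + ‖ξ‖) ^ α * (1 + Real.sqrt (Real.log (1 + |ω|))) * (t - s) ^ γ))

/-- The norm `N_α` of a space-time vector field given through its Fourier transform `bhat`. -/
def FLnorm (d : ℕ) (α : ℝ) (bhat : ℝ × Euc d → Fin d → ℂ) : ℝ≥0∞ :=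
  ∫⁻ p : ℝ × Euc d, ENNReal.ofReal (‖bhat p‖ * (1 + ‖p.2‖) ^ α *
    (1 + Real.sqrt (Real.log (1 + |p.1|))))

/-- The vector field `b(t,x)` recovered from its space-time Fourier transform. -/
def fieldOf {d : ℕ} (bhat : ℝ × Euc d → Fin d → ℂ) (t : ℝ) (x : Euc d) : Euc d :=
  (EuclideanSpace.equiv (Fin d) ℝ).symm fun i =>
    ∫ p : ℝ × Euc d, (bhat p i * Complex.exp (Complex.I * Complex.ofReal (p.1 * t + inner ℝ p.2 x))).re

/-- The averaged vector field `σ^w_{[s,t]} b`, defined through the Fourier representation. -/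
def sigmaAvg {d : ℕ} (w : ℝ → Euc d) (bhat : ℝ × Euc d → Fin d → ℂ) (s t : ℝ) (x : Euc d) :
    Euc d :=
  (EuclideanSpace.equiv (Fin d) ℝ).symm fun i =>
    ∫ p : ℝ × Euc d, (bhat p i * Yint w s t p.1 p.2 *
      Complex.exp (Complex.I * Complex.ofReal (inner ℝ p.2 x))).re

/-- Partitions of the interval `[s,t]`. -/
structure IcPartition (s t : ℝ) where
  n : ℕ
  pts : ℕ → ℝ
  first : pts 0 = s
  last : pts n = t
  mono : ∀ i, i < n → pts i ≤ pts (i + 1)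

/-- The mesh of the partition is smaller than `δ`. -/
def IcPartition.MeshLt {s t : ℝ} (P : IcPartition s t) (δ : ℝ) : Prop :=
  ∀ i, i < P.n → P.pts (i + 1) - P.pts i < δ

/-- Riemann sums `Σ_i (G_{t_{i+1}} - G_{t_i})(f_{t_i})` of the nonlinear Young integral. -/
def RiemannSum {V W : Type*} [AddCommGroup W] (G : ℝ → V → W) (f : ℝ → V)
    {s t : ℝ} (P : IcPartition s t) : W :=
  ∑ i ∈ Finset.range P.n, (G (P.pts (i + 1)) (f (P.pts i)) - G (P.pts i) (f (P.pts i)))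

/-- `L` is the nonlinear Young integral `∫_s^t G_{du}(f_u)`: the Riemann sums converge to `L`
as the mesh of the partition tends to `0`. -/
def HasYoungIntegral {V W : Type*} [NormedAddCommGroup W] (G : ℝ → V → W) (f : ℝ → V)
    (s t : ℝ) (L : W) : Prop :=
  ∀ ε > 0, ∃ δ > 0, ∀ P : IcPartition s t, P.MeshLt δ → ‖RiemannSum G f P - L‖ < ε

/-- Riemann sums `Σ_i (σ^w_{[t_i,t_{i+1}]} b)(θ_{t_i})`. -/
def sigmaRiemannSum {d : ℕ} (w : ℝ → Euc d) (bhat : ℝ × Euc d → Fin d → ℂ)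
    (θ : ℝ → Euc d) {s t : ℝ} (P : IcPartition s t) : Euc d :=
  ∑ i ∈ Finset.range P.n, sigmaAvg w bhat (P.pts i) (P.pts (i + 1)) (θ (P.pts i))

/-- `L = ∫_s^t (σ^w_{du} b)(θ_u)` as a limit of Riemann sums. -/
def HasSigmaIntegral {d : ℕ} (w : ℝ → Euc d) (bhat : ℝ × Euc d → Fin d → ℂ)
    (θ : ℝ → Euc d) (s t : ℝ) (L : Euc d) : Prop :=
  ∀ ε > 0, ∃ δ > 0, ∀ P : IcPartition s t, P.MeshLt δ → ‖sigmaRiemannSum w bhat θ P - L‖ < ε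

/-- `θ` solves the Young equation `θ_t = x₀ + ∫_0^t (σ^w_{du} b)(θ_u)` on `[0,1]`. -/
def SolvesSigmaYoung {d : ℕ} (w : ℝ → Euc d) (bhat : ℝ × Euc d → Fin d → ℂ)
    (x₀ : Euc d) (θ : ℝ → Euc d) : Prop :=
  θ 0 = x₀ ∧ ∀ t ∈ Set.Icc (0 : ℝ) 1, HasSigmaIntegral w bhat θ 0 t (θ t - x₀)

/-- `γ`-Hölder continuity on `[0,1]`. -/
def HolderOnIcc {E : Type*} [NormedAddCommGroup E] (γ : ℝ) (f : ℝ → E) : Prop :=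
  ∃ C : ℝ, ∀ s ∈ Set.Icc (0 : ℝ) 1, ∀ t ∈ Set.Icc (0 : ℝ) 1, ‖f t - f s‖ ≤ C * |t - s| ^ γ

/-- Covariance of the fractional Brownian motion of Hurst index `H`. -/
def fbmCov (H : ℝ) (s t : ℝ) : ℝ := (s ^ (2 * H) + t ^ (2 * H) - |t - s| ^ (2 * H)) / 2

/-- `W` is a `d`-dimensional fractional Brownian motion of Hurst parameter `H` with continuous
sample paths: the coordinates are independent centered Gaussian processes with the fBm
covariance, expressed by asking every finite linear combination to be Gaussian. -/
def IsFBM {Ω : Type*} [MeasureSpace Ω] (d : ℕ) (H : ℝ) (W : Ω → ℝ → Euc d) : Prop :=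
  (∀ ω, ContinuousOn (W ω) (Set.Icc 0 1)) ∧
  (∀ t, Measurable fun ω => W ω t) ∧
  (∀ ω, W ω 0 = 0) ∧
  ∀ (n : ℕ) (c : Fin n → ℝ) (t : Fin n → ℝ) (j : Fin n → Fin d),
    (∀ k, t k ∈ Set.Icc (0 : ℝ) 1) →
    Measure.map (fun ω => ∑ k, c k * W ω (t k) (j k)) (volume : Measure Ω) =
      ProbabilityTheory.gaussianReal 0
        (Real.toNNReal (∑ k, ∑ l, c k * c l *
          (if j k = j l then fbmCov H (t k) (t l) else 0)))

/-- `R^w_λ = (∫_0^1 exp(λ |w_u|²) du)^{1/λ}`. -/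
def Rconst {d : ℕ} (lam : ℝ) (w : ℝ → Euc d) : ℝ≥0∞ :=
  (∫⁻ u in Set.Icc (0 : ℝ) 1, ENNReal.ofReal (Real.exp (lam * ‖w u‖ ^ 2))) ^ (1 / lam)

/-- `S^w_λ`. -/
def Sconst {d : ℕ} (H lam : ℝ) (w : ℝ → Euc d) : ℝ≥0∞ :=
  (∑' n : ℕ, ∑' m : ℕ, ∑ k ∈ Finset.range (2 ^ n), ∑' q : ℤ × (Fin d → ℤ),
    ENNReal.ofReal (
      (2 : ℝ) ^ (-(2 * (n : ℝ)) - (m : ℝ) * ((d : ℝ) + 2)) *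
      (1 + |(q.1 : ℝ) / 2 ^ m|) ^ (-(2 : ℝ)) *
      (1 + ‖(EuclideanSpace.equiv (Fin d) ℝ).symm (fun i => (q.2 i : ℝ) / 2 ^ m)‖) ^
        (-((d : ℝ) + 1)) *
      Real.exp (lam * 2 ^ n *
        (1 + ‖(EuclideanSpace.equiv (Fin d) ℝ).symm (fun i => (q.2 i : ℝ) / 2 ^ m)‖) ^ (1 / H) *
        ‖Yint w ((k : ℝ) / 2 ^ n) (((k : ℝ) + 1) / 2 ^ n) ((q.1 : ℝ) / 2 ^ m)
          ((EuclideanSpace.equiv (Fin d) ℝ).symm (fun i => (q.2 i : ℝ) / 2 ^ m))‖ ^ 2))) ^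
  (1 / lam)

/-- `Q^w_λ = √(log S^w_λ) + √(log R^w_λ)`. -/
def Qconst {d : ℕ} (H lam : ℝ) (w : ℝ → Euc d) : ℝ :=
  Real.sqrt (Real.log (Sconst H lam w).toReal) + Real.sqrt (Real.log (Rconst lam w).toReal)

/-- The largest dyadic number of level `m` below `s`. -/
def dyadicFloor (m : ℕ) (s : ℝ) : ℝ := (⌊(2 : ℝ) ^ m * s⌋₊ : ℝ) / 2 ^ m

lemma dyadicFloor_le (m : ℕ) {s : ℝ} (hs : 0 ≤ s) : dyadicFloor m s ≤ s := by
  unfold dyadicFloor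
  rw [div_le_iff₀ (by positivity), mul_comm s]
  exact Nat.floor_le (by positivity)

lemma sub_lt_dyadicFloor (m : ℕ) (s : ℝ) : s - (2 ^ m)⁻¹ < dyadicFloor m s := by
  unfold dyadicFloor
  rw [lt_div_iff₀ (by positivity), sub_mul, inv_mul_cancel₀ (by positivity), mul_comm s]
  exact Nat.sub_one_lt_floor _

lemma dyadicFloor_nonneg (m : ℕ) (s : ℝ) : 0 ≤ dyadicFloor m s := by
  unfold dyadicFloor; positivity

lemma tendsto_dyadicFloor {s : ℝ} (hs : 0 ≤ s) :
    Tendsto (fun m => dyadicFloor m s) atTop (𝓝 s) := by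
  have h : Tendsto (fun m : ℕ => s - ((2 : ℝ) ^ m)⁻¹) atTop (𝓝 (s - 0)) := by
    refine tendsto_const_nhds.sub ?_
    simpa using tendsto_pow_atTop_nhds_zero_of_lt_one (r := (2 : ℝ)⁻¹) (by norm_num) (by norm_num)
  rw [sub_zero] at h
  exact tendsto_of_tendsto_of_tendsto_of_le_of_le h tendsto_const_nhds
    (fun m => (sub_lt_dyadicFloor m s).le) (fun m => dyadicFloor_le m hs)

/-- Increments over adjacent dyadic points control increments over dyadic floors of the same level
whose distance is less than two steps. -/
lemma norm_sub_dyadic_le {E : Type*} [NormedAddCommGroup E] {X : ℝ → E} {B : ℝ} (hB : 0 ≤ B)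
    {m : ℕ} (hX : ∀ k : ℕ, k < 2 ^ m → ‖X ((k + 1 : ℝ) / 2 ^ m) - X ((k : ℝ) / 2 ^ m)‖ ≤ B)
    {a b : ℕ} (hab : a ≤ b) (hba : b ≤ a + 1) (hb : b ≤ 2 ^ m) :
    ‖X ((b : ℝ) / 2 ^ m) - X ((a : ℝ) / 2 ^ m)‖ ≤ B := by
  rcases Nat.eq_or_lt_of_le hab with h | h
  · subst h; simpa using hB
  · obtain rfl : b = a + 1 := by omega
    simpa using hX a (by omega)

lemma norm_sub_dyadicFloor_succ_le {E : Type*} [NormedAddCommGroup E] {X : ℝ → E} {B : ℝ}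
    (hB : 0 ≤ B) {m : ℕ}
    (hX : ∀ k : ℕ, k < 2 ^ (m + 1) →
      ‖X ((k + 1 : ℝ) / 2 ^ (m + 1)) - X ((k : ℝ) / 2 ^ (m + 1))‖ ≤ B)
    {s : ℝ} (hs : 0 ≤ s) (hs1 : s ≤ 1) :
    ‖X (dyadicFloor (m + 1) s) - X (dyadicFloor m s)‖ ≤ B := by
  have e : dyadicFloor m s = ((2 * ⌊(2 : ℝ) ^ m * s⌋₊ : ℕ) : ℝ) / 2 ^ (m + 1) := by
    unfold dyadicFloor
    rw [pow_succ]; push_cast; field_simp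
  rw [e]
  have h1 := Nat.floor_le (a := (2 : ℝ) ^ m * s) (by positivity)
  have h2 := Nat.lt_floor_add_one ((2 : ℝ) ^ m * s)
  refine norm_sub_dyadic_le hB hX ?_ ?_ ?_
  · refine Nat.le_floor ?_
    push_cast; rw [pow_succ]; linarith
  · refine Nat.lt_succ_iff.1 ((Nat.floor_lt (by positivity)).2 ?_)
    push_cast; rw [pow_succ]; linarith
  · refine Nat.floor_le_of_le ?_
    push_cast
    exact mul_le_of_le_one_right (by positivity) hs1

lemma norm_sub_dyadicFloor_le {E : Type*} [NormedAddCommGroup E] {X : ℝ → E}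
    (hc : ContinuousOn X (Set.Icc 0 1)) {ρ A : ℝ} (hρ0 : 0 < ρ) (hρ : ρ < 1) (hA : 0 ≤ A)
    (hX : ∀ m k : ℕ, k < 2 ^ m →
      ‖X ((k + 1 : ℝ) / 2 ^ m) - X ((k : ℝ) / 2 ^ m)‖ ≤ A * ρ ^ m)
    {s : ℝ} (hs : s ∈ Set.Icc (0 : ℝ) 1) (n : ℕ) :
    ‖X s - X (dyadicFloor n s)‖ ≤ A * ρ ^ n / (1 - ρ) := by
  have key : ∀ j : ℕ, ‖X (dyadicFloor (n + j) s) - X (dyadicFloor n s)‖ ≤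
      A * ρ ^ n * (1 - ρ ^ j) / (1 - ρ) := by
    intro j
    induction j with
    | zero => simp
    | succ j ih =>
      have h := norm_sub_dyadicFloor_succ_le (m := n + j) (B := A * ρ ^ (n + j + 1))
        (by positivity) (hX (n + j + 1)) hs.1 hs.2
      have h3 := norm_sub_le_norm_sub_add_norm_sub (X (dyadicFloor (n + (j + 1)) s))
        (X (dyadicFloor (n + j) s)) (X (dyadicFloor n s))
      have h4 : A * ρ ^ (n + j + 1) ≤ A * ρ ^ (n + j) := by
        gcongr 1
        exact pow_le_pow_of_le_one hρ0.le hρ.le (by omega)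
      have h5 : A * ρ ^ n * (1 - ρ ^ (j + 1)) / (1 - ρ) =
          A * ρ ^ (n + j) + A * ρ ^ n * (1 - ρ ^ j) / (1 - ρ) := by
        have : (1 - ρ) ≠ 0 := by linarith
        field_simp
        ring
      rw [h5]
      refine h3.trans (add_le_add (h.trans h4) ih)
  have hlim : Tendsto (fun j : ℕ => ‖X (dyadicFloor (n + j) s) - X (dyadicFloor n s)‖) atTop
      (𝓝 ‖X s - X (dyadicFloor n s)‖) := by
    refine Tendsto.norm (Tendsto.sub_const ?_ _)
    have h1 : Tendsto (fun j => dyadicFloor (n + j) s) atTop (𝓝[Set.Icc 0 1] s) := by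
      refine tendsto_nhdsWithin_iff.2 ⟨?_, Eventually.of_forall fun j =>
        ⟨dyadicFloor_nonneg _ _, (dyadicFloor_le _ hs.1).trans hs.2⟩⟩
      exact (tendsto_dyadicFloor hs.1).comp (tendsto_atTop_mono (fun j => Nat.le_add_left j n) tendsto_id)
    exact (hc s hs).tendsto.comp h1
  refine le_of_tendsto' hlim fun j => (key j).trans ?_
  have : 0 < 1 - ρ := by linarith
  refine div_le_div_of_nonneg_right (mul_le_of_le_one_right (by positivity) ?_) this.le
  have := pow_pos hρ0 j
  linarith

/-- **Dyadic chaining**: a continuous function on `[0,1]` whose increments over dyadic intervals of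
level `m` are at most `A * 2 ^ (-mθ)` is `θ`-Hölder, with constant proportional to `A`. -/
theorem holder_of_dyadic {θ : ℝ} (hθ : 0 < θ) : ∃ C : ℝ, 0 ≤ C ∧
    ∀ {E : Type} [NormedAddCommGroup E] (X : ℝ → E) (A : ℝ), ContinuousOn X (Set.Icc 0 1) →
      0 ≤ A →
      (∀ m k : ℕ, k < 2 ^ m →
        ‖X ((k + 1 : ℝ) / 2 ^ m) - X ((k : ℝ) / 2 ^ m)‖ ≤ A * (((2 : ℝ) ^ m)⁻¹) ^ θ) →
      ∀ s t : ℝ, 0 ≤ s → s < t → t ≤ 1 → ‖X t - X s‖ ≤ C * A * (t - s) ^ θ := by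
  set ρ : ℝ := (2 : ℝ)⁻¹ ^ θ with hρdef
  have hρ0 : 0 < ρ := by positivity
  have hρ : ρ < 1 := Real.rpow_lt_one (by norm_num) (by norm_num) hθ
  have hpow : ∀ m : ℕ, (((2 : ℝ) ^ m)⁻¹) ^ θ = ρ ^ m := fun m => by
    rw [hρdef, ← inv_pow, ← Real.rpow_natCast, ← Real.rpow_natCast, ← Real.rpow_mul (by norm_num),
      ← Real.rpow_mul (by norm_num), mul_comm]
  have hρ1 : 0 < 1 - ρ := by linarith
  refine ⟨(2 / (1 - ρ) + 1) * 2 ^ θ, by positivity, ?_⟩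
  intro E _ X A hc hA hX s t hs hst ht
  simp only [hpow] at hX
  obtain ⟨n, hn1, hn2⟩ : ∃ n : ℕ, (2 : ℝ)⁻¹ ^ (n + 1) < t - s ∧ t - s ≤ 2⁻¹ ^ n :=
    exists_nat_pow_near_of_lt_one (by linarith) (by linarith) (by norm_num) (by norm_num)
  have hs' : s ∈ Set.Icc (0 : ℝ) 1 := ⟨hs, by linarith⟩
  have ht' : t ∈ Set.Icc (0 : ℝ) 1 := ⟨by linarith, ht⟩
  have h1 := norm_sub_dyadicFloor_le hc hρ0 hρ hA hX hs' n
  have h2 := norm_sub_dyadicFloor_le hc hρ0 hρ hA hX ht' n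
  have h3 : ‖X (dyadicFloor n t) - X (dyadicFloor n s)‖ ≤ A * ρ ^ n := by
    have hpn : (0 : ℝ) < 2 ^ n := by positivity
    refine norm_sub_dyadic_le (by positivity) (hX n) (Nat.floor_mono (by gcongr)) ?_ ?_
    · have : (2 : ℝ) ^ n * t ≤ 2 ^ n * s + 1 := by
        rw [inv_pow] at hn2
        have := mul_le_mul_of_nonneg_left hn2 hpn.le
        rw [mul_inv_cancel₀ hpn.ne'] at this
        linarith
      calc ⌊(2 : ℝ) ^ n * t⌋₊ ≤ ⌊(2 : ℝ) ^ n * s + 1⌋₊ := Nat.floor_mono this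
        _ = _ := Nat.floor_add_one (by positivity)
    · refine Nat.floor_le_of_le ?_
      push_cast
      exact mul_le_of_le_one_right (by positivity) ht
  have h4 : ρ ^ n ≤ 2 ^ θ * (t - s) ^ θ := by
    rw [← hpow, ← Real.mul_rpow (by norm_num) (by linarith)]
    refine Real.rpow_le_rpow (by positivity) ?_ hθ.le
    rw [pow_succ] at hn1
    rw [← inv_pow]; linarith
  have h5 : ‖X t - X s‖ ≤ ‖X t - X (dyadicFloor n t)‖ +
      ‖X (dyadicFloor n t) - X (dyadicFloor n s)‖ + ‖X s - X (dyadicFloor n s)‖ := by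
    have := norm_add₃_le (a := X t - X (dyadicFloor n t))
      (b := X (dyadicFloor n t) - X (dyadicFloor n s)) (c := -(X s - X (dyadicFloor n s)))
    rw [norm_neg] at this
    refine le_trans (le_of_eq ?_) this
    congr 1; abel
  calc ‖X t - X s‖ ≤ A * ρ ^ n / (1 - ρ) + A * ρ ^ n + A * ρ ^ n / (1 - ρ) := by linarith
    _ = (2 / (1 - ρ) + 1) * A * ρ ^ n := by ring
    _ ≤ (2 / (1 - ρ) + 1) * A * (2 ^ θ * (t - s) ^ θ) := by gcongr
    _ = _ := by ring

lemma integrable_of_even {f : ℝ → ℝ} (he : ∀ x, f (-x) = f x)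
    (hf : IntegrableOn f (Set.Ioi 0)) : Integrable f := by
  rw [← integrableOn_univ, ← Set.Iic_union_Ioi (a := (0 : ℝ))]
  refine IntegrableOn.union ?_ hf
  rw [← integrableOn_Ici_iff_integrableOn_Ioi] at hf
  have h := (Measure.measurePreserving_neg (volume : Measure ℝ)).integrableOn_comp_preimage
    (Homeomorph.neg ℝ).measurableEmbedding (f := f) (s := Set.Ici 0)
  have h' := h.2 hf
  simpa [Function.comp_def, he] using h'

lemma integrable_one_sub_cos_mul_rpow {H : ℝ} (hH : 0 < H) (hH1 : H < 1) :
    Integrable (fun x : ℝ => (1 - Real.cos (2 * Real.pi * x)) * |x| ^ (-1 - 2 * H)) := by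
  refine integrable_of_even (fun x => by simp) ?_
  have hm : AEStronglyMeasurable
      (fun x : ℝ => (1 - Real.cos (2 * Real.pi * x)) * |x| ^ (-1 - 2 * H)) volume := by
    apply Measurable.aestronglyMeasurable
    fun_prop
  rw [← Set.Ioc_union_Ioi_eq_Ioi (zero_le_one : (0 : ℝ) ≤ 1)]
  refine IntegrableOn.union ?_ ?_
  · have h : IntegrableOn (fun x : ℝ => (2 * Real.pi) ^ 2 / 2 * x ^ (1 - 2 * H)) (Set.Ioc 0 1) := by
      refine Integrable.const_mul ?_ _
      exact (intervalIntegrable_iff_integrableOn_Ioc_of_le zero_le_one).1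
        (intervalIntegral.intervalIntegrable_rpow' (by linarith))
    refine Integrable.mono' h hm.restrict ?_
    refine (ae_restrict_iff' measurableSet_Ioc).2 (Eventually.of_forall fun x hx => ?_)
    have h1 := Real.one_sub_sq_div_two_le_cos (x := 2 * Real.pi * x)
    have h2 := Real.cos_le_one (2 * Real.pi * x)
    have h3 : x ^ (1 - 2 * H) = x ^ 2 * x ^ (-1 - 2 * H) := by
      rw [← Real.rpow_natCast, ← Real.rpow_add hx.1]; norm_num; ring_nf
    rw [abs_of_pos hx.1, Real.norm_of_nonneg (mul_nonneg (by linarith) (Real.rpow_nonneg hx.1.le _)),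
      h3, ← mul_assoc]
    refine mul_le_mul_of_nonneg_right ?_ (Real.rpow_nonneg hx.1.le _)
    nlinarith
  · have h : IntegrableOn (fun x : ℝ => 2 * x ^ (-1 - 2 * H)) (Set.Ioi 1) :=
      (integrableOn_Ioi_rpow_of_lt (by linarith) one_pos).const_mul 2
    refine Integrable.mono' h hm.restrict ?_
    refine (ae_restrict_iff' measurableSet_Ioi).2 (Eventually.of_forall fun x hx => ?_)
    have hx0 : 0 < x := lt_trans one_pos hx
    have h1 := Real.neg_one_le_cos (2 * Real.pi * x)
    have h2 := Real.cos_le_one (2 * Real.pi * x)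
    rw [abs_of_pos hx0, Real.norm_of_nonneg (mul_nonneg (by linarith) (Real.rpow_nonneg hx0.le _))]
    exact mul_le_mul_of_nonneg_right (by linarith) (Real.rpow_nonneg hx0.le _)

/-- The spectral constant `∫ (1 - cos (2πx)) |x|^(-1-2H) dx`. -/
def spectralConst (H : ℝ) : ℝ := ∫ x : ℝ, (1 - Real.cos (2 * Real.pi * x)) * |x| ^ (-1 - 2 * H)

lemma spectralConst_nonneg (H : ℝ) : 0 ≤ spectralConst H :=
  integral_nonneg fun x => mul_nonneg (by linarith [Real.cos_le_one (2 * Real.pi * x)])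
    (Real.rpow_nonneg (abs_nonneg x) _)

/-- The spectral representation of `|y|^(2H)`. -/
lemma spectral_representation {H : ℝ} (hH : 0 < H) (hH1 : H < 1) (y : ℝ) :
    Integrable (fun x : ℝ => (1 - Real.cos (2 * Real.pi * (y * x))) * |x| ^ (-1 - 2 * H)) ∧
    ∫ x : ℝ, (1 - Real.cos (2 * Real.pi * (y * x))) * |x| ^ (-1 - 2 * H) =
      spectralConst H * |y| ^ (2 * H) := by
  rcases eq_or_ne y 0 with rfl | hy
  · have : (2 * H) ≠ 0 := by linarith
    simp [Real.zero_rpow this]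
  have hy' : 0 < |y| := abs_pos.2 hy
  have e : (fun x : ℝ => (1 - Real.cos (2 * Real.pi * (y * x))) * |x| ^ (-1 - 2 * H)) =
      fun x => |y| ^ (1 + 2 * H) * ((1 - Real.cos (2 * Real.pi * (y * x))) *
        |y * x| ^ (-1 - 2 * H)) := by
    funext x
    rw [abs_mul, Real.mul_rpow (abs_nonneg _) (abs_nonneg _)]
    have : |y| ^ (1 + 2 * H) * |y| ^ (-1 - 2 * H) = 1 := by
      rw [← Real.rpow_add hy']; ring_nf; simp
    linear_combination (-(1 - Real.cos (2 * Real.pi * (y * x))) * |x| ^ (-1 - 2 * H)) * this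
  rw [e]
  refine ⟨((integrable_one_sub_cos_mul_rpow hH hH1).comp_mul_left' hy).const_mul _, ?_⟩
  rw [integral_const_mul, Measure.integral_comp_mul_left
    (fun x => (1 - Real.cos (2 * Real.pi * x)) * |x| ^ (-1 - 2 * H)) y, smul_eq_mul, ← spectralConst,
    abs_inv, Real.rpow_add hy', Real.rpow_one]
  field_simp

lemma norm_sq_sum_exp {ι : Type*} [Fintype ι] (ε θ : ι → ℝ) :
    ‖∑ j, (ε j : ℂ) * Complex.exp (θ j * Complex.I)‖ ^ 2 =
      ∑ j, ∑ l, ε j * ε l * Real.cos (θ j - θ l) := by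
  have h : ∑ j, (ε j : ℂ) * Complex.exp (θ j * Complex.I) =
      ((∑ j, ε j * Real.cos (θ j) : ℝ) : ℂ) + ((∑ j, ε j * Real.sin (θ j) : ℝ) : ℂ) * Complex.I := by
    push_cast
    rw [Finset.sum_mul, ← Finset.sum_add_distrib]
    refine Finset.sum_congr rfl fun j _ => ?_
    rw [Complex.exp_mul_I]; ring
  rw [h, ← Complex.normSq_eq_norm_sq, Complex.normSq_add_mul_I, sq, sq, Finset.sum_mul_sum,
    Finset.sum_mul_sum, ← Finset.sum_add_distrib]
  refine Finset.sum_congr rfl fun j _ => ?_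
  rw [← Finset.sum_add_distrib]
  refine Finset.sum_congr rfl fun l _ => ?_
  rw [Real.cos_sub]; ring

/-- Spectral form of the variance of a combination of increments. -/
lemma integral_norm_sq_sum_exp {H : ℝ} (hH : 0 < H) (hH1 : H < 1) {ι : Type*} [Fintype ι]
    (ε u : ι → ℝ) (hε : ∑ j, ε j = 0) (v : ℝ) :
    Integrable (fun x : ℝ => ‖∑ j, (ε j : ℂ) *
      Complex.exp ((2 * Real.pi * ((v - u j) * x) : ℝ) * Complex.I)‖ ^ 2 * |x| ^ (-1 - 2 * H)) ∧
    ∫ x : ℝ, ‖∑ j, (ε j : ℂ) *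
      Complex.exp ((2 * Real.pi * ((v - u j) * x) : ℝ) * Complex.I)‖ ^ 2 * |x| ^ (-1 - 2 * H) =
      spectralConst H * (-∑ j, ∑ l, ε j * ε l * |u j - u l| ^ (2 * H)) := by
  have e : (fun x : ℝ => ‖∑ j, (ε j : ℂ) *
      Complex.exp ((2 * Real.pi * ((v - u j) * x) : ℝ) * Complex.I)‖ ^ 2 * |x| ^ (-1 - 2 * H)) =
      fun x => ∑ j, ∑ l, (-(ε j * ε l)) *
        ((1 - Real.cos (2 * Real.pi * ((u j - u l) * x))) * |x| ^ (-1 - 2 * H)) := by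
    funext x
    have h0 : ∑ j, ∑ l, ε j * ε l = 0 := by
      rw [← Finset.sum_mul_sum, hε, zero_mul]
    have h1 : ∑ j, ∑ l, ε j * ε l *
        Real.cos (2 * Real.pi * ((v - u j) * x) - 2 * Real.pi * ((v - u l) * x)) =
        ∑ j, ∑ l, (-(ε j * ε l)) * (1 - Real.cos (2 * Real.pi * ((u j - u l) * x))) := by
      rw [← sub_eq_zero, ← h0, ← Finset.sum_sub_distrib]
      refine Finset.sum_congr rfl fun j _ => ?_
      rw [← Finset.sum_sub_distrib]
      refine Finset.sum_congr rfl fun l _ => ?_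
      have : Real.cos (2 * Real.pi * ((v - u j) * x) - 2 * Real.pi * ((v - u l) * x)) =
          Real.cos (2 * Real.pi * ((u j - u l) * x)) := by
        rw [← Real.cos_neg]; ring_nf
      rw [this]; ring
    rw [norm_sq_sum_exp, h1, Finset.sum_mul]
    refine Finset.sum_congr rfl fun j _ => ?_
    rw [Finset.sum_mul]
    exact Finset.sum_congr rfl fun l _ => mul_assoc _ _ _
  have hi : ∀ j l, Integrable (fun x : ℝ => (-(ε j * ε l)) *
        ((1 - Real.cos (2 * Real.pi * ((u j - u l) * x))) * |x| ^ (-1 - 2 * H))) := fun j l =>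
    (spectral_representation hH hH1 _).1.const_mul _
  rw [e]
  refine ⟨integrable_finsetSum _ fun j _ => integrable_finsetSum _ fun l _ => hi j l, ?_⟩
  rw [integral_finsetSum _ fun j _ => integrable_finsetSum _ fun l _ => hi j l,
    ← Finset.sum_neg_distrib, Finset.mul_sum]
  refine Finset.sum_congr rfl fun j _ => ?_
  rw [integral_finsetSum _ fun l _ => hi j l, ← Finset.sum_neg_distrib, Finset.mul_sum]
  refine Finset.sum_congr rfl fun l _ => ?_
  rw [integral_const_mul, (spectral_representation hH hH1 _).2]
  ring

/-- An integrable profile whose inverse Fourier transform is a bump function. -/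
lemma exists_bump_profile {H : ℝ} (hH : 0 < H) (hH1 : H < 1) : ∃ φ : ℝ → ℂ, Integrable φ ∧
    Integrable (fun x => ‖φ x‖ ^ 2 * |x| ^ (1 + 2 * H)) ∧
    (∫ x : ℝ, φ x = 1) ∧
    ∀ y : ℝ, 1 ≤ |y| → ∫ x : ℝ, Complex.exp ((2 * Real.pi * (y * x) : ℝ) * Complex.I) * φ x = 0 := by
  let b : ContDiffBump (0 : ℝ) := ⟨1 / 2, 1, by norm_num, by norm_num⟩
  let f : SchwartzMap ℝ ℂ := HasCompactSupport.toSchwartzMap (f := fun x => ((b x : ℝ) : ℂ))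
    (b.hasCompactSupport.comp_left (g := fun x : ℝ => (x : ℂ)) Complex.ofReal_zero)
    (Complex.ofRealCLM.contDiff.comp b.contDiff)
  have hf : ∀ x, f x = ((b x : ℝ) : ℂ) := fun x => rfl
  let φ : SchwartzMap ℝ ℂ := FourierTransform.fourier f
  have hinv : ∀ y : ℝ, ∫ x : ℝ, Complex.exp ((2 * Real.pi * (y * x) : ℝ) * Complex.I) * φ x =
      ((b y : ℝ) : ℂ) := by
    intro y
    have hff : FourierTransformInv.fourierInv φ = f := FourierTransform.fourierInv_fourier_eq f
    rw [← hf, ← hff, SchwartzMap.fourierInv_coe, Real.fourierInv_eq']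
    refine integral_congr_ae (Eventually.of_forall fun x => ?_)
    simp only [smul_eq_mul]
    congr 3
  refine ⟨φ, φ.integrable, ?_, ?_, fun y hy => ?_⟩
  · obtain ⟨C, hC⟩ : ∃ C : ℝ, ∀ x, ‖φ x‖ ≤ C := by
      obtain ⟨C, -, hC⟩ := φ.decay 0 0
      exact ⟨C, fun x => by simpa using hC x⟩
    have h0 := (φ.integrable_pow_mul volume 0).const_mul C
    have h3 := (φ.integrable_pow_mul volume 3).const_mul C
    refine Integrable.mono' (h0.add h3) ?_ (Eventually.of_forall fun x => ?_)
    · have : Continuous φ := φ.continuous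
      apply Measurable.aestronglyMeasurable
      fun_prop
    · rw [Real.norm_of_nonneg (by positivity)]
      have h1 : |x| ^ (1 + 2 * H) ≤ 1 + |x| ^ 3 := by
        rcases le_total |x| 1 with h | h
        · have := Real.rpow_le_one (abs_nonneg x) h (by linarith : 0 ≤ 1 + 2 * H)
          have : 0 ≤ |x| ^ 3 := by positivity
          linarith
        · have := Real.rpow_le_rpow_of_exponent_le h (by push_cast; linarith : 1 + 2 * H ≤ (3 : ℕ))
          rw [Real.rpow_natCast] at this
          linarith
      have h2 : ‖φ x‖ ^ 2 ≤ C * ‖φ x‖ := by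
        rw [sq]; exact mul_le_mul_of_nonneg_right (hC x) (norm_nonneg _)
      calc ‖φ x‖ ^ 2 * |x| ^ (1 + 2 * H) ≤ C * ‖φ x‖ * (1 + |x| ^ 3) :=
            mul_le_mul h2 h1 (by positivity) ((sq_nonneg _).trans h2)
        _ = _ := by simp only [Pi.add_apply, Real.norm_eq_abs]; ring
  · have := hinv 0
    rw [b.one_of_mem_closedBall (by simp [b])] at this
    simpa using this
  · rw [hinv y, b.zero_of_le_dist (by simpa [b] using hy), Complex.ofReal_zero]

/-- Local nondeterminism at unit distance. -/
lemma local_nondeterminism_unit {H : ℝ} (hH : 0 < H) (hH1 : H < 1) : ∃ c : ℝ, 0 < c ∧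
    ∀ {ι : Type} [Fintype ι] (ε u : ι → ℝ) (k : ι), ∑ j, ε j = 0 → |ε k| = 1 →
      (∀ j, j ≠ k → 1 ≤ |u k - u j|) →
      c ≤ -∑ j, ∑ l, ε j * ε l * |u j - u l| ^ (2 * H) := by
  classical
  obtain ⟨φ, hφ, hφ2, hφ1, hφ0⟩ := exists_bump_profile hH hH1
  set K : ℝ := ∫ x, ‖φ x‖ ^ 2 * |x| ^ (1 + 2 * H) with hK
  have hK0 : 0 ≤ K := integral_nonneg fun x => by positivity
  have hS := spectralConst_nonneg H
  refine ⟨1 / ((K + 1) * (spectralConst H + 1)), by positivity, ?_⟩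
  intro ι _ ε u k hε hk hu
  obtain ⟨hZi, hZ⟩ := integral_norm_sq_sum_exp hH hH1 ε u hε (u k)
  set V : ℝ := -∑ j, ∑ l, ε j * ε l * |u j - u l| ^ (2 * H)
  set z : ℝ → ℂ := fun x => ∑ j, (ε j : ℂ) *
      Complex.exp ((2 * Real.pi * ((u k - u j) * x) : ℝ) * Complex.I) with hz
  have hexp : ∀ j, Integrable fun x : ℝ =>
      Complex.exp ((2 * Real.pi * ((u k - u j) * x) : ℝ) * Complex.I) * φ x := fun j =>
    hφ.bdd_mul (c := 1) (by fun_prop) (Eventually.of_forall fun x => by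
      rw [Complex.norm_exp_ofReal_mul_I])
  have hint : ∫ x, z x * φ x = ε k := by
    have e : (fun x => z x * φ x) = fun x => ∑ j, (ε j : ℂ) *
        (Complex.exp ((2 * Real.pi * ((u k - u j) * x) : ℝ) * Complex.I) * φ x) := by
      funext x
      rw [hz, Finset.sum_mul]
      exact Finset.sum_congr rfl fun j _ => mul_assoc _ _ _
    rw [e, integral_finsetSum _ fun j _ => (hexp j).const_mul _, Finset.sum_eq_single k]
    · rw [integral_const_mul]
      simp [hφ1]
    · intro j _ hj
      rw [integral_const_mul, hφ0 _ (hu j hj), mul_zero]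
    · simp
  have h1 : 1 ≤ ∫ x, ‖z x * φ x‖ := by
    calc 1 = ‖∫ x, z x * φ x‖ := by rw [hint, Complex.norm_real, Real.norm_eq_abs, hk]
      _ ≤ _ := norm_integral_le_integral_norm _
  have h2 : ∫ x, ‖z x * φ x‖ ≤ ∫ x, ((K + 1) / 2 * (‖z x‖ ^ 2 * |x| ^ (-1 - 2 * H)) +
      1 / (2 * (K + 1)) * (‖φ x‖ ^ 2 * |x| ^ (1 + 2 * H))) := by
    refine integral_mono_of_nonneg (Eventually.of_forall fun x => norm_nonneg _)
      ((hZi.const_mul _).add (hφ2.const_mul _)) ?_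
    have hne : ∀ᵐ x : ℝ, x ≠ 0 := by simp [ae_iff]
    filter_upwards [hne] with x hx
    have hx' : 0 < |x| := abs_pos.2 hx
    have hab : |x| ^ (-1 - 2 * H) * |x| ^ (1 + 2 * H) = 1 := by
      rw [← Real.rpow_add hx']; ring_nf; simp
    have ha := Real.rpow_pos_of_pos hx' (1 + 2 * H)
    have hinv : |x| ^ (-1 - 2 * H) = (|x| ^ (1 + 2 * H))⁻¹ := eq_inv_of_mul_eq_one_left hab
    rw [norm_mul, hinv]
    set a := |x| ^ (1 + 2 * H)
    have hsq : 0 ≤ ((K + 1) * ‖z x‖ - a * ‖φ x‖) ^ 2 / (2 * (K + 1) * a) := by positivity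
    have : (K + 1) / 2 * (‖z x‖ ^ 2 * a⁻¹) + 1 / (2 * (K + 1)) * (‖φ x‖ ^ 2 * a) - ‖z x‖ * ‖φ x‖ =
        ((K + 1) * ‖z x‖ - a * ‖φ x‖) ^ 2 / (2 * (K + 1) * a) := by
      field_simp; ring
    linarith
  rw [integral_add (hZi.const_mul _) (hφ2.const_mul _), integral_const_mul, integral_const_mul, hZ,
    ← hK] at h2
  have h3 : 1 / (2 * (K + 1)) * K ≤ 1 / 2 := by
    rw [div_mul_eq_mul_div, div_le_iff₀ (by positivity)]; linarith
  have h4 : 1 ≤ (K + 1) * (spectralConst H * V) := by linarith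
  have hV : 0 ≤ V := by
    by_contra! hneg
    have : spectralConst H * V ≤ 0 := mul_nonpos_of_nonneg_of_nonpos hS hneg.le
    nlinarith
  rw [div_le_iff₀ (by positivity)]
  nlinarith

/-- **Local nondeterminism** of the fractional kernel: if the point `u k` is at distance at least
`r` from all other points, the quadratic form is at least of order `r ^ (2H)`. -/
theorem local_nondeterminism {H : ℝ} (hH : 0 < H) (hH1 : H < 1) : ∃ c : ℝ, 0 < c ∧
    ∀ {ι : Type} [Fintype ι] (ε u : ι → ℝ) (k : ι) (r : ℝ), 0 < r → ∑ j, ε j = 0 → |ε k| = 1 →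
      (∀ j, j ≠ k → r ≤ |u k - u j|) →
      c * r ^ (2 * H) ≤ -∑ j, ∑ l, ε j * ε l * |u j - u l| ^ (2 * H) := by
  obtain ⟨c, hc, h⟩ := local_nondeterminism_unit hH hH1
  refine ⟨c, hc, fun {ι} _ ε u k r hr hε hk hu => ?_⟩
  have h1 := h ε (fun j => u j / r) k hε hk fun j hj => by
    rw [← sub_div, abs_div, abs_of_pos hr, le_div_iff₀ hr, one_mul]
    exact hu j hj
  have h2 : ∑ j, ∑ l, ε j * ε l * |u j - u l| ^ (2 * H) =
      (∑ j, ∑ l, ε j * ε l * |u j / r - u l / r| ^ (2 * H)) * r ^ (2 * H) := by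
    rw [Finset.sum_mul]
    refine Finset.sum_congr rfl fun j _ => ?_
    rw [Finset.sum_mul]
    refine Finset.sum_congr rfl fun l _ => ?_
    rw [← sub_div, abs_div, abs_of_pos hr, mul_assoc _ (_ ^ _), ← Real.mul_rpow (by positivity) hr.le,
      div_mul_cancel₀ _ hr.ne']
  rw [h2, ← neg_mul]
  exact mul_le_mul_of_nonneg_right h1 (Real.rpow_nonneg hr.le _)

/-- In a graph on `2p` vertices without isolated vertices, some `p` vertices all have a neighbour
in the complementary set. -/
lemma exists_half_dominated {ι : Type*} [Fintype ι] [DecidableEq ι] {p : ℕ}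
    (hcard : Fintype.card ι = 2 * p) (near : ι → ι → Prop) (hsymm : ∀ k j, near k j → near j k)
    (h : ∀ k, ∃ j, j ≠ k ∧ near k j) :
    ∃ S : Finset ι, S.card = p ∧ ∀ k ∈ S, ∃ j, j ∉ S ∧ near k j := by
  let P : Finset ι → Prop := fun D => ∀ k, k ∉ D → ∃ j ∈ D, near k j
  have huse : ∀ D : Finset ι, P D → D.card ≤ p →
      ∃ S : Finset ι, S.card = p ∧ ∀ k ∈ S, ∃ j, j ∉ S ∧ near k j := by
    intro D hD hDp
    obtain ⟨D', hDD', -, hD'⟩ := Finset.exists_subsuperset_card_eq (Finset.subset_univ D) hDp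
      (by rw [Finset.card_univ, hcard]; omega)
    refine ⟨D'ᶜ, by rw [Finset.card_compl, hcard, hD']; omega, fun k hk => ?_⟩
    obtain ⟨j, hj, hkj⟩ := hD k fun hkD => (Finset.mem_compl.1 hk) (hDD' hkD)
    exact ⟨j, by simpa using hDD' hj, hkj⟩
  obtain ⟨D, hD, hmin⟩ : ∃ D : Finset ι, P D ∧ ∀ D', P D' → D.card ≤ D'.card := by
    have hne : ({D : Finset ι | P D}).Nonempty := ⟨Finset.univ, fun k hk => by simp at hk⟩
    obtain ⟨D, hD, hm⟩ := exists_minimal_of_wellFoundedLT (fun n => ∃ D, P D ∧ D.card = n)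
      ⟨_, Finset.univ, fun k hk => by simp at hk, rfl⟩
    obtain ⟨D₀, h1, rfl⟩ := hD
    refine ⟨D₀, h1, fun D' hD' => ?_⟩
    by_contra! hlt
    exact absurd (hm ⟨D', hD', rfl⟩ hlt.le) (by omega)
  rcases le_or_gt D.card p with hp | hp
  · exact huse D hD hp
  · refine huse Dᶜ (fun k hk => ?_) (by rw [Finset.card_compl, hcard]; omega)
    have hk : k ∈ D := by simpa using hk
    by_contra! hno
    have hno' : ∀ j, near k j → j ∈ D := fun j hj => by
      by_contra hjD; exact hno j (by simpa using hjD) hj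
    refine absurd (hmin (D.erase k) fun j hj => ?_) (by
      have := Finset.card_erase_lt_of_mem hk; omega)
    by_cases hjk : j = k
    · subst hjk
      obtain ⟨i, hi, hji⟩ := h j
      exact ⟨i, Finset.mem_erase.2 ⟨hi, hno' i hji⟩, hji⟩
    · have hjD : j ∉ D := fun hjD => hj (Finset.mem_erase.2 ⟨hjk, hjD⟩)
      obtain ⟨i, hi, hji⟩ := hD j hjD
      refine ⟨i, Finset.mem_erase.2 ⟨?_, hi⟩, hji⟩
      rintro rfl
      exact hjD (hno' j (hsymm _ _ hji))

lemma integral_exp_neg_mul_abs_rpow {q b : ℝ} (hq : 0 < q) (hb : 0 < b) :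
    Integrable (fun x : ℝ => Real.exp (-b * |x| ^ q)) ∧
    ∫ x : ℝ, Real.exp (-b * |x| ^ q) = 2 * (b ^ (-1 / q) * Real.Gamma (1 / q + 1)) := by
  constructor
  · refine integrable_of_even (fun x => by simp) ?_
    have h := integrableOn_rpow_mul_exp_neg_mul_rpow (s := 0) (by norm_num) hq hb
    refine h.congr_fun (fun x hx => ?_) measurableSet_Ioi
    simp [abs_of_pos (Set.mem_Ioi.1 hx)]
  · rw [integral_comp_abs (f := fun x => Real.exp (-b * x ^ q)), integral_exp_neg_mul_rpow hq hb]

lemma integral_prod_subtype_sub_le {ι : Type*} [Fintype ι] (P : ι → Prop)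
    [DecidablePred P] (n : ι → ι) (hn : ∀ k, P k → ¬ P (n k)) {g : ℝ → ℝ} (hgm : Measurable g)
    (hg0 : ∀ x, 0 ≤ g x) (hg1 : ∀ x, g x ≤ 1) (hgi : Integrable g) (μ : Measure ℝ)
    [IsFiniteMeasure μ] (hμ : μ ≤ volume) :
    Integrable (fun u : ι → ℝ => ∏ k : {k // P k}, g (u k - u (n k))) (Measure.pi fun _ => μ) ∧
    ∫ u : ι → ℝ, ∏ k : {k // P k}, g (u k - u (n k)) ∂(Measure.pi fun _ => μ) ≤
      (∫ x, g x) ^ Fintype.card {k // P k} * (μ.real Set.univ) ^ Fintype.card {k // ¬ P k} := by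
  have hm : Measurable (fun u : ι → ℝ => ∏ k : {k // P k}, g (u k - u (n k))) := by fun_prop
  have hint : Integrable (fun u : ι → ℝ => ∏ k : {k // P k}, g (u k - u (n k)))
      (Measure.pi fun _ => μ) := by
    refine Integrable.of_bound (C := 1) hm.aestronglyMeasurable (Eventually.of_forall fun u => ?_)
    rw [Real.norm_of_nonneg (Finset.prod_nonneg fun k _ => hg0 _)]
    exact Finset.prod_le_one (fun k _ => hg0 _) fun k _ => hg1 _
  refine ⟨hint, ?_⟩
  have hmp := measurePreserving_piEquivPiSubtypeProd (fun _ : ι => μ) P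
  set e := MeasurableEquiv.piEquivPiSubtypeProd (fun _ : ι => ℝ) P
  let F : ({k // P k} → ℝ) × ({k // ¬ P k} → ℝ) → ℝ := fun z =>
    ∏ k : {k // P k}, g (z.1 k - z.2 ⟨n k, hn k k.2⟩)
  have hF : (fun u : ι → ℝ => ∏ k : {k // P k}, g (u k - u (n k))) = F ∘ e := rfl
  have hFi : Integrable F ((Measure.pi fun _ : {k // P k} => μ).prod
      (Measure.pi fun _ : {k // ¬ P k} => μ)) := by
    rw [hF] at hint
    exact (hmp.integrable_comp_emb e.measurableEmbedding).1 hint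
  have hcomp : ∫ u : ι → ℝ, ∏ k : {k // P k}, g (u k - u (n k)) ∂(Measure.pi fun _ => μ) =
      ∫ z, F z ∂((Measure.pi fun _ : {k // P k} => μ).prod
        (Measure.pi fun _ : {k // ¬ P k} => μ)) := hmp.integral_comp' F
  rw [hcomp, integral_prod_symm F hFi]
  have hinner : ∀ y : {k // ¬ P k} → ℝ,
      ∫ x : {k // P k} → ℝ, F (x, y) ∂(Measure.pi fun _ => μ) ≤
        (∫ x, g x) ^ Fintype.card {k // P k} := by
    intro y
    have h1 := integral_fintype_prod_eq_prod (𝕜 := ℝ) (μ := fun _ : {k // P k} => μ)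
      (fun (k : {k // P k}) (x : ℝ) => g (x - y ⟨n k, hn k k.2⟩))
    simp only [F]
    rw [h1]
    calc ∏ k : {k // P k}, ∫ x, g (x - y ⟨n k, hn k k.2⟩) ∂μ
        ≤ ∏ k : {k // P k}, ∫ x, g x := by
          refine Finset.prod_le_prod (fun k _ => integral_nonneg fun x => hg0 _) fun k _ => ?_
          rw [← integral_sub_right_eq_self g (y ⟨n k, hn k k.2⟩)]
          exact integral_mono_measure hμ (Eventually.of_forall fun x => hg0 _)
            (hgi.comp_sub_right _)
      _ = _ := by simp
  calc _ ≤ ∫ y : {k // ¬ P k} → ℝ, (∫ x, g x) ^ Fintype.card {k // P k}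
          ∂(Measure.pi fun _ => μ) :=
        integral_mono hFi.integral_prod_right (integrable_const _) hinner
    _ = _ := by
        rw [integral_const, smul_eq_mul, mul_comm]
        congr 1
        simp [Measure.real, Measure.pi_univ]

lemma integral_prod_sub_le {ι : Type*} [Fintype ι] [DecidableEq ι] (S : Finset ι) (n : ι → ι)
    (hn : ∀ k ∈ S, n k ∉ S) {g : ℝ → ℝ} (hgm : Measurable g) (hg0 : ∀ x, 0 ≤ g x)
    (hg1 : ∀ x, g x ≤ 1) (hgi : Integrable g) (μ : Measure ℝ) [IsFiniteMeasure μ]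
    (hμ : μ ≤ volume) :
    Integrable (fun u : ι → ℝ => ∏ k ∈ S, g (u k - u (n k))) (Measure.pi fun _ => μ) ∧
    ∫ u : ι → ℝ, ∏ k ∈ S, g (u k - u (n k)) ∂(Measure.pi fun _ => μ) ≤
      (∫ x, g x) ^ S.card * (μ.real Set.univ) ^ Sᶜ.card := by
  have h := integral_prod_subtype_sub_le (fun k => k ∈ S) n hn hgm hg0 hg1 hgi μ hμ
  have e : ∀ u : ι → ℝ, ∏ k ∈ S, g (u k - u (n k)) = ∏ k : {k // k ∈ S}, g (u k - u (n k)) :=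
    fun u => Finset.prod_subtype S (fun _ => Iff.rfl) _
  have hc : Fintype.card {k // k ∉ S} = Sᶜ.card := Fintype.card_of_subtype _ fun k => by simp
  simp only [e, ← hc]
  rw [← Fintype.card_coe S]
  convert h

/-- The quadratic form of the fractional kernel. -/
def fracForm (H : ℝ) {ι : Type*} [Fintype ι] (ε u : ι → ℝ) : ℝ :=
  -∑ j, ∑ l, ε j * ε l * |u j - u l| ^ (2 * H)

lemma exists_close_of_local_nondeterminism {H c : ℝ} (hH : 0 < H)
    {ι : Type} [Fintype ι] [Nontrivial ι] (ε u : ι → ℝ) (k : ι)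
    (hLND : ∀ r : ℝ, 0 < r → (∀ j, j ≠ k → r ≤ |u k - u j|) → c * r ^ (2 * H) ≤ fracForm H ε u) :
    ∃ j, j ≠ k ∧ c * |u k - u j| ^ (2 * H) ≤ max (fracForm H ε u) 0 := by
  classical
  by_contra! hno
  have hne : (Finset.univ.erase k).Nonempty := by
    obtain ⟨j, hj⟩ := exists_ne k
    exact ⟨j, by simpa using hj⟩
  obtain ⟨i, hi, hmin⟩ := Finset.exists_min_image _ (fun j => |u k - u j|) hne
  have hik : i ≠ k := by simpa using hi
  have h1 := hno i hik
  have hpos : 0 < |u k - u i| := by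
    refine (abs_nonneg _).lt_of_ne fun h0 => ?_
    rw [← h0, Real.zero_rpow (by positivity), mul_zero] at h1
    exact absurd h1 (not_lt.2 (le_max_right _ _))
  have h2 := hLND _ hpos fun j hj => hmin j (by simpa using hj)
  exact absurd (h2.trans (le_max_left _ _)) (not_le.2 h1)

/-- The key integral estimate behind the moment bounds. -/
theorem integral_exp_neg_fracForm_le {H : ℝ} (hH : 0 < H) (hH1 : H < 1) {p : ℕ} (hp : 0 < p)
    {ι : Type} [Fintype ι] (hcard : Fintype.card ι = 2 * p) (ε : ι → ℝ) (hε : ∑ j, ε j = 0)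
    (hε1 : ∀ j, |ε j| = 1) :
    ∃ C : ℝ, 0 ≤ C ∧ ∀ a b y : ℝ, a ≤ b → 0 < y →
      ∫ u : ι → ℝ, Real.exp (-(y ^ 2 * max (fracForm H ε u) 0 / 4))
        ∂(Measure.pi fun _ => (volume : Measure ℝ).restrict (Set.Icc a b)) ≤
      C * (b - a) ^ p * y ^ (-(p : ℝ) / H) := by
  classical
  obtain ⟨c, hc, hLND⟩ := local_nondeterminism hH hH1
  have hp' : (0 : ℝ) < p := by exact_mod_cast hp
  have : Nontrivial ι := Fintype.one_lt_card_iff_nontrivial.1 (by omega)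
  let T : Finset (Finset ι × (ι → ι)) :=
    Finset.univ.filter fun z => z.1.card = p ∧ ∀ k ∈ z.1, z.2 k ∉ z.1
  let G : ℝ := 2 * ((c / (4 * p)) ^ (-1 / (2 * H)) * Real.Gamma (1 / (2 * H) + 1))
  have hG : 0 ≤ G := by
    have := Real.Gamma_nonneg_of_nonneg (by positivity : 0 ≤ 1 / (2 * H) + 1)
    positivity
  refine ⟨T.card * G ^ p, by positivity, fun a b y hab hy => ?_⟩
  set μ : Measure ℝ := (volume : Measure ℝ).restrict (Set.Icc a b) with hμ
  have hμr : μ.real Set.univ = b - a := by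
    rw [hμ, measureReal_restrict_apply_univ, Real.volume_real_Icc_of_le hab]
  set B : ℝ := c / (4 * p) * y ^ 2 with hB
  have hB0 : 0 < B := by positivity
  set g : ℝ → ℝ := fun x => Real.exp (-B * |x| ^ (2 * H)) with hg
  obtain ⟨hgi, hgint⟩ := integral_exp_neg_mul_abs_rpow (q := 2 * H) (by positivity) hB0
  have hgm : Measurable g := by fun_prop
  have hgI : ∫ x, g x = G * y ^ (-1 / H) := by
    rw [hg, hgint, hB, Real.mul_rpow (by positivity) (by positivity)]
    have : (y ^ 2) ^ (-1 / (2 * H)) = y ^ (-1 / H) := by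
      rw [← Real.rpow_natCast, ← Real.rpow_mul hy.le]
      congr 1; push_cast; field_simp
    rw [this]; ring
  have hg1 : ∀ x, g x ≤ 1 := fun x => Real.exp_le_one_iff.2 (by
    have := Real.rpow_nonneg (abs_nonneg x) (2 * H)
    nlinarith)
  have hterm : ∀ z ∈ T, Integrable (fun u : ι → ℝ => ∏ k ∈ z.1, g (u k - u (z.2 k)))
        (Measure.pi fun _ => μ) ∧
      ∫ u : ι → ℝ, ∏ k ∈ z.1, g (u k - u (z.2 k)) ∂(Measure.pi fun _ => μ) ≤
        (G * y ^ (-1 / H)) ^ p * (b - a) ^ p := by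
    intro z hz
    obtain ⟨hz1, hz2⟩ := (Finset.mem_filter.1 hz).2
    have h := integral_prod_sub_le z.1 z.2 hz2 hgm (fun x => (Real.exp_pos _).le) hg1 hgi μ
      Measure.restrict_le_self
    rwa [hz1, Finset.card_compl, hz1, hcard, hgI, hμr, show 2 * p - p = p by omega] at h
  have hpt : ∀ u : ι → ℝ, Real.exp (-(y ^ 2 * max (fracForm H ε u) 0 / 4)) ≤
      ∑ z ∈ T, ∏ k ∈ z.1, g (u k - u (z.2 k)) := by
    intro u
    set V := max (fracForm H ε u) 0
    obtain ⟨S, hS, hSn⟩ := exists_half_dominated hcard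
      (fun k j => c * |u k - u j| ^ (2 * H) ≤ V) (fun k j h => by rwa [abs_sub_comm])
      (fun k => exists_close_of_local_nondeterminism hH ε u k fun r hr hu =>
        hLND ε u k r hr hε (hε1 k) hu)
    choose! n hn using hSn
    have hmem : (S, n) ∈ T := Finset.mem_filter.2 ⟨Finset.mem_univ _, hS, fun k hk => (hn k hk).1⟩
    refine le_trans ?_ (Finset.single_le_sum (f := fun z : Finset ι × (ι → ι) =>
      ∏ k ∈ z.1, g (u k - u (z.2 k)))
      (fun z _ => Finset.prod_nonneg fun k _ => (Real.exp_pos _).le) hmem)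
    have h1 : Real.exp (-(y ^ 2 * V / 4)) = ∏ k ∈ S, Real.exp (-(y ^ 2 * V / (4 * p))) := by
      rw [Finset.prod_const, hS, ← Real.exp_nat_mul]
      congr 1; field_simp
    rw [h1]
    refine Finset.prod_le_prod (fun k _ => (Real.exp_pos _).le) fun k hk => ?_
    rw [hg]
    refine Real.exp_le_exp.2 ?_
    have h2 := (hn k hk).2
    have h3 : B * |u k - u (n k)| ^ (2 * H) =
        y ^ 2 / (4 * p) * (c * |u k - u (n k)| ^ (2 * H)) := by rw [hB]; ring
    have h4 := mul_le_mul_of_nonneg_left h2 (by positivity : 0 ≤ y ^ 2 / (4 * p))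
    have h5 : y ^ 2 * V / (4 * p) = y ^ 2 / (4 * p) * V := by ring
    rw [neg_mul, h3, h5]
    linarith
  calc _ ≤ ∫ u : ι → ℝ, ∑ z ∈ T, ∏ k ∈ z.1, g (u k - u (z.2 k)) ∂(Measure.pi fun _ => μ) :=
        integral_mono_of_nonneg (Eventually.of_forall fun u => (Real.exp_pos _).le)
          (integrable_finsetSum _ fun z hz => (hterm z hz).1) (Eventually.of_forall hpt)
    _ = ∑ z ∈ T, ∫ u : ι → ℝ, ∏ k ∈ z.1, g (u k - u (z.2 k)) ∂(Measure.pi fun _ => μ) :=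
        integral_finsetSum _ fun z hz => (hterm z hz).1
    _ ≤ ∑ z ∈ T, (G * y ^ (-1 / H)) ^ p * (b - a) ^ p := Finset.sum_le_sum fun z hz => (hterm z hz).2
    _ = _ := by
        rw [Finset.sum_const, nsmul_eq_mul, mul_pow, ← Real.rpow_natCast (y ^ (-1 / H)),
          ← Real.rpow_mul hy.le, show -1 / H * (p : ℝ) = -(p : ℝ) / H by ring]
        ring

lemma IsFBM.map_sum {Ω : Type*} [MeasureSpace Ω] {d : ℕ} {H : ℝ} {W : Ω → ℝ → Euc d}
    (hW : IsFBM d H W) {κ : Type*} [Fintype κ] (c t : κ → ℝ) (j : κ → Fin d)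
    (ht : ∀ k, t k ∈ Set.Icc (0 : ℝ) 1) :
    Measure.map (fun ω => ∑ k, c k * W ω (t k) (j k)) (volume : Measure Ω) =
      ProbabilityTheory.gaussianReal 0 (Real.toNNReal (∑ k, ∑ l, c k * c l *
          (if j k = j l then fbmCov H (t k) (t l) else 0))) := by
  let e := Fintype.equivFin κ
  have h := hW.2.2.2 _ (c ∘ e.symm) (t ∘ e.symm) (j ∘ e.symm) fun k => ht _
  have h1 : ∀ ω, ∑ k, (c ∘ e.symm) k * W ω ((t ∘ e.symm) k) ((j ∘ e.symm) k) =
      ∑ k, c k * W ω (t k) (j k) := fun ω =>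
    Equiv.sum_comp e.symm fun k => c k * W ω (t k) (j k)
  have h2 : ∑ k, ∑ l, (c ∘ e.symm) k * (c ∘ e.symm) l *
      (if (j ∘ e.symm) k = (j ∘ e.symm) l then
        fbmCov H ((t ∘ e.symm) k) ((t ∘ e.symm) l) else 0) =
      ∑ k, ∑ l, c k * c l * (if j k = j l then fbmCov H (t k) (t l) else 0) := by
    rw [← Equiv.sum_comp e.symm]
    refine Finset.sum_congr rfl fun k _ => ?_
    rw [← Equiv.sum_comp e.symm (fun l => c (e.symm k) * c l *
      (if j (e.symm k) = j l then fbmCov H (t (e.symm k)) (t l) else 0))]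
    rfl
  simp only [h1] at h
  rw [h2] at h
  exact h

lemma sum_mul_fbmCov {H : ℝ} {ι : Type*} [Fintype ι] (ε u : ι → ℝ) (hε : ∑ j, ε j = 0) :
    ∑ j, ∑ l, ε j * ε l * fbmCov H (u j) (u l) = fracForm H ε u / 2 := by
  have h1 : ∀ j l, ε j * ε l * fbmCov H (u j) (u l) =
      (ε j * u j ^ (2 * H)) * ε l / 2 + ε j * (ε l * u l ^ (2 * H)) / 2 -
        ε j * ε l * |u j - u l| ^ (2 * H) / 2 := by
    intro j l
    rw [fbmCov, abs_sub_comm]; ring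
  simp only [h1, Finset.sum_sub_distrib, Finset.sum_add_distrib, ← Finset.sum_div,
    ← Finset.mul_sum, ← Finset.sum_mul, hε, fracForm]
  ring

lemma IsFBM.norm_integral_exp {Ω : Type*} [MeasureSpace Ω] {d : ℕ} {H : ℝ}
    {W : Ω → ℝ → Euc d} (hW : IsFBM d H W) {ι : Type*} [Fintype ι] (ε u : ι → ℝ)
    (hε : ∑ j, ε j = 0) (hu : ∀ j, u j ∈ Set.Icc (0 : ℝ) 1) (ξ : Euc d) (r : ℝ) :
    ‖∫ x : Ω, Complex.exp (Complex.I * ((∑ j, ε j * inner ℝ ξ (W x (u j)) + r : ℝ) : ℂ))‖ =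
      Real.exp (-(‖ξ‖ ^ 2 * max (fracForm H ε u) 0 / 4)) := by
  have hmap := hW.map_sum (κ := ι × Fin d) (fun z => ε z.1 * ξ z.2) (fun z => u z.1)
    (fun z => z.2) (fun z => hu _)
  have hsum : ∀ x, ∑ z : ι × Fin d, ε z.1 * ξ z.2 * W x (u z.1) z.2 =
      ∑ j, ε j * inner ℝ ξ (W x (u j)) := by
    intro x
    rw [Fintype.sum_prod_type]
    refine Finset.sum_congr rfl fun j _ => ?_
    rw [PiLp.inner_apply, Finset.mul_sum]
    refine Finset.sum_congr rfl fun i _ => ?_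
    simp only [RCLike.inner_apply, conj_trivial]
    ring
  have hvar : ∑ z : ι × Fin d, ∑ z' : ι × Fin d, ε z.1 * ξ z.2 * (ε z'.1 * ξ z'.2) *
      (if z.2 = z'.2 then fbmCov H (u z.1) (u z'.1) else 0) =
      ‖ξ‖ ^ 2 * (fracForm H ε u / 2) := by
    rw [← sum_mul_fbmCov ε u hε, Fintype.sum_prod_type, Finset.mul_sum]
    refine Finset.sum_congr rfl fun j _ => ?_
    simp only [Fintype.sum_prod_type]
    rw [Finset.sum_comm, Finset.mul_sum]
    refine Finset.sum_congr rfl fun l _ => ?_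
    simp only [mul_ite, mul_zero, Finset.sum_ite_eq, Finset.mem_univ, if_true]
    rw [EuclideanSpace.norm_sq_eq, Finset.sum_mul]
    refine Finset.sum_congr rfl fun i _ => ?_
    rw [Real.norm_eq_abs, sq_abs]
    ring
  simp only [hsum] at hmap
  rw [hvar] at hmap
  have hmeas : Measurable fun x => ∑ j, ε j * inner ℝ ξ (W x (u j)) := by
    refine Finset.measurable_sum _ fun j _ => ?_
    exact ((continuous_const.inner continuous_id).measurable.comp (hW.2.1 (u j))).const_mul _
  have hchar := ProbabilityTheory.charFun_gaussianReal (μ := 0)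
    (v := (‖ξ‖ ^ 2 * (fracForm H ε u / 2)).toNNReal) 1
  rw [← hmap, charFun_apply_real, integral_map hmeas.aemeasurable (by fun_prop)] at hchar
  have hsplit : ∀ x, Complex.exp (Complex.I * ((∑ j, ε j * inner ℝ ξ (W x (u j)) + r : ℝ) : ℂ)) =
      Complex.exp (((1 : ℝ) : ℂ) * ((∑ j, ε j * inner ℝ ξ (W x (u j)) : ℝ) : ℂ) * Complex.I) *
        Complex.exp (r * Complex.I) := by
    intro x
    rw [← Complex.exp_add]
    congr 1
    push_cast; ring
  simp only [hsplit]
  rw [integral_mul_const, hchar, norm_mul, Complex.norm_exp_ofReal_mul_I, mul_one,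
    Complex.norm_exp]
  congr 1
  have hv : (((‖ξ‖ ^ 2 * (fracForm H ε u / 2)).toNNReal : ℝ≥0) : ℝ) =
      ‖ξ‖ ^ 2 * max (fracForm H ε u) 0 / 2 := by
    rw [Real.coe_toNNReal']
    rcases le_total (fracForm H ε u) 0 with h | h
    · rw [max_eq_right h, max_eq_right (by nlinarith [sq_nonneg ‖ξ‖])]; simp
    · rw [max_eq_left h, max_eq_left (by positivity)]; ring
  have hc : ∀ v : ℝ, ((((1 : ℝ) : ℂ) * ((0 : ℝ) : ℂ) * Complex.I - (v : ℂ) * ((1 : ℝ) : ℂ) ^ 2 / 2)).re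
      = -(v / 2) := by
    intro v
    have : (((1 : ℝ) : ℂ) * ((0 : ℝ) : ℂ) * Complex.I - (v : ℂ) * ((1 : ℝ) : ℂ) ^ 2 / 2) =
      ((-(v / 2) : ℝ) : ℂ) := by push_cast; ring
    rw [this, Complex.ofReal_re]
  rw [hc, hv]
  ring

/-- The signs attached to the `p` factors `Y` and the `p` factors `conj Y` of `|Y|^(2p)`. -/
def pairSign (p : ℕ) : Fin p × Bool → ℝ := fun z => if z.2 then 1 else -1

lemma sum_pairSign (p : ℕ) : ∑ z, pairSign p z = 0 := by
  simp [pairSign, Fintype.sum_prod_type]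

lemma abs_pairSign (p : ℕ) (z : Fin p × Bool) : |pairSign p z| = 1 := by
  unfold pairSign; split_ifs <;> simp

lemma norm_Yint_pow_eq {d : ℕ} {w : ℝ → Euc d} (p : ℕ) {s t : ℝ}
    (hst : s ≤ t) (ω : ℝ) (ξ : Euc d) :
    ((‖Yint w s t ω ξ‖ ^ (2 * p) : ℝ) : ℂ) = ∫ u : Fin p × Bool → ℝ,
      Complex.exp (Complex.I * ((∑ z, pairSign p z * inner ℝ ξ (w (u z)) +
        ∑ z, pairSign p z * (ω * u z) : ℝ) : ℂ))
      ∂(Measure.pi fun _ => (volume : Measure ℝ).restrict (Set.Icc s t)) := by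
  have h1 := integral_fintype_prod_eq_prod (𝕜 := ℂ)
    (μ := fun _ : Fin p × Bool => (volume : Measure ℝ).restrict (Set.Icc s t))
    (fun (z : Fin p × Bool) (v : ℝ) =>
      Complex.exp (Complex.I * ((pairSign p z * (inner ℝ ξ (w v) + ω * v) : ℝ) : ℂ)))
  have h2 : ∀ u : Fin p × Bool → ℝ,
      ∏ z, Complex.exp (Complex.I * ((pairSign p z * (inner ℝ ξ (w (u z)) + ω * u z) : ℝ) : ℂ)) =
      Complex.exp (Complex.I * ((∑ z, pairSign p z * inner ℝ ξ (w (u z)) +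
        ∑ z, pairSign p z * (ω * u z) : ℝ) : ℂ)) := by
    intro u
    rw [← Complex.exp_sum, ← Finset.sum_add_distrib, ← Finset.mul_sum]
    congr 2
    push_cast
    exact Finset.sum_congr rfl fun z _ => by ring
  simp only [h2] at h1
  rw [h1, Fintype.prod_prod_type]
  have hY : Yint w s t ω ξ = ∫ v, Complex.exp (Complex.I * ((inner ℝ ξ (w v) + ω * v : ℝ) : ℂ))
      ∂((volume : Measure ℝ).restrict (Set.Icc s t)) := by
    rw [Yint, intervalIntegral.integral_of_le hst, integral_Icc_eq_integral_Ioc]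
  have hc : (starRingEnd ℂ) (Yint w s t ω ξ) =
      ∫ v, Complex.exp (Complex.I * ((-(inner ℝ ξ (w v) + ω * v) : ℝ) : ℂ))
      ∂((volume : Measure ℝ).restrict (Set.Icc s t)) := by
    rw [hY, ← integral_conj]
    refine integral_congr_ae (Eventually.of_forall fun v => ?_)
    simp only
    rw [← Complex.exp_conj, map_mul, Complex.conj_I, Complex.conj_ofReal]
    congr 1
    push_cast; ring
  have hin : ∀ i : Fin p, ∏ b : Bool, ∫ v, Complex.exp (Complex.I *
      ((pairSign p (i, b) * (inner ℝ ξ (w v) + ω * v) : ℝ) : ℂ))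
      ∂((volume : Measure ℝ).restrict (Set.Icc s t)) = ((‖Yint w s t ω ξ‖ ^ 2 : ℝ) : ℂ) := by
    intro i
    rw [Fintype.prod_bool]
    simp only [pairSign, if_true, one_mul, Bool.false_eq_true, if_false, neg_one_mul]
    rw [← hY, ← hc, Complex.mul_conj, Complex.normSq_eq_norm_sq]
  simp only [hin]
  rw [Finset.prod_const, Finset.card_univ, Fintype.card_fin, ← Complex.ofReal_pow, pow_mul]

lemma measurable_process {Ω : Type*} [MeasureSpace Ω] {d : ℕ} {H : ℝ}
    {W : Ω → ℝ → Euc d} (hW : IsFBM d H W) (hc : ∀ x, Continuous (W x)) :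
    Measurable fun z : Ω × ℝ => W z.1 z.2 := by
  have h := measurable_uncurry_of_continuous_of_measurable (u := fun (t : ℝ) (x : Ω) => W x t)
    (fun x => hc x) (fun t => hW.2.1 t)
  exact h.comp measurable_swap

lemma measurable_Yint {Ω : Type*} [MeasureSpace Ω] {d : ℕ} {H : ℝ}
    {W : Ω → ℝ → Euc d} (hW : IsFBM d H W) (hc : ∀ x, Continuous (W x)) (s t ω : ℝ) (ξ : Euc d) :
    Measurable fun x => Yint (W x) s t ω ξ := by
  have hm : Measurable fun z : Ω × ℝ =>
      Complex.exp (Complex.I * ((inner ℝ ξ (W z.1 z.2) + ω * z.2 : ℝ) : ℂ)) := by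
    have h1 : Measurable fun z : Ω × ℝ => inner ℝ ξ (W z.1 z.2) :=
      (continuous_const.inner continuous_id).measurable.comp (measurable_process hW hc)
    fun_prop
  simp only [Yint, intervalIntegral]
  exact ((hm.stronglyMeasurable.integral_prod_right' (ν := volume.restrict (Set.Ioc s t))).sub
    (hm.stronglyMeasurable.integral_prod_right' (ν := volume.restrict (Set.Ioc t s)))).measurable

lemma norm_Yint_le {d : ℕ} (w : ℝ → Euc d) {s t : ℝ} (hst : s ≤ t) (ω : ℝ) (ξ : Euc d) :
    ‖Yint w s t ω ξ‖ ≤ t - s := by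
  have h := intervalIntegral.norm_integral_le_of_norm_le_const (a := s) (b := t) (C := 1)
    (f := fun u => Complex.exp (Complex.I * ((inner ℝ ξ (w u) + ω * u : ℝ) : ℂ)))
    (fun u _ => by rw [mul_comm, Complex.norm_exp_ofReal_mul_I])
  rwa [abs_of_nonneg (by linarith), one_mul] at h

lemma exists_integral_norm_Yint_pow_le {Ω : Type*} [MeasureSpace Ω]
    [IsProbabilityMeasure (volume : Measure Ω)] {d : ℕ} {H : ℝ} (hH : 0 < H) (hH1 : H < 1)
    {W : Ω → ℝ → Euc d} (hW : IsFBM d H W) (hc : ∀ x, Continuous (W x)) {p : ℕ} (hp : 0 < p) :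
    ∃ C : ℝ, 0 ≤ C ∧ ∀ (s t ω : ℝ) (ξ : Euc d), 0 ≤ s → s ≤ t → t ≤ 1 → ξ ≠ 0 →
      ∫ x : Ω, ‖Yint (W x) s t ω ξ‖ ^ (2 * p) ≤ C * (t - s) ^ p * ‖ξ‖ ^ (-(p : ℝ) / H) := by
  obtain ⟨C, hC, hbound⟩ := integral_exp_neg_fracForm_le hH hH1 hp (ι := Fin p × Bool)
    (by simp [mul_comm]) (pairSign p) (sum_pairSign p) (abs_pairSign p)
  refine ⟨C, hC, fun s t ω ξ hs hst ht hξ => ?_⟩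
  refine le_trans ?_ (hbound s t ‖ξ‖ hst (norm_pos_iff.2 hξ))
  set μ : Measure (Fin p × Bool → ℝ) :=
    Measure.pi fun _ => (volume : Measure ℝ).restrict (Set.Icc s t) with hμ
  let F : Ω → (Fin p × Bool → ℝ) → ℂ := fun x u =>
    Complex.exp (Complex.I * ((∑ z, pairSign p z * inner ℝ ξ (W x (u z)) +
        ∑ z, pairSign p z * (ω * u z) : ℝ) : ℂ))
  have hFm : Measurable (Function.uncurry F) := by
    have h1 : ∀ z, Measurable fun y : Ω × (Fin p × Bool → ℝ) => inner ℝ ξ (W y.1 (y.2 z)) :=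
      fun z => (continuous_const.inner continuous_id).measurable.comp
        ((measurable_process hW hc).comp
          (measurable_fst.prodMk ((measurable_pi_apply z).comp measurable_snd)))
    simp only [F, Function.uncurry_def]
    fun_prop
  have hFn : ∀ x u, ‖F x u‖ = 1 := fun x u => by
    simp only [F]; rw [mul_comm, Complex.norm_exp_ofReal_mul_I]
  have hFi : Integrable (Function.uncurry F) ((volume : Measure Ω).prod μ) :=
    Integrable.of_bound (C := 1) hFm.aestronglyMeasurable
      (Eventually.of_forall fun z => (hFn z.1 z.2).le)
  have hswap := integral_integral_swap hFi
  have hY : ∀ x, ∫ u, F x u ∂μ = ((‖Yint (W x) s t ω ξ‖ ^ (2 * p) : ℝ) : ℂ) := fun x =>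
    (norm_Yint_pow_eq p hst ω ξ).symm
  simp only [hY] at hswap
  rw [integral_complex_ofReal] at hswap
  have h0 : 0 ≤ ∫ x : Ω, ‖Yint (W x) s t ω ξ‖ ^ (2 * p) := integral_nonneg fun x => by positivity
  rw [← Real.norm_of_nonneg h0, ← Complex.norm_real, hswap]
  refine (norm_integral_le_integral_norm _).trans (le_of_eq ?_)
  refine integral_congr_ae ?_
  have hmem : ∀ᵐ u ∂μ, ∀ z, u z ∈ Set.Icc s t := by
    rw [ae_all_iff]
    intro z
    exact (Measure.tendsto_eval_ae_ae (μ := fun _ : Fin p × Bool =>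
      (volume : Measure ℝ).restrict (Set.Icc s t)) (i := z)).eventually
      (ae_restrict_mem measurableSet_Icc)
  filter_upwards [hmem] with u hu
  exact hW.norm_integral_exp (pairSign p) u (sum_pairSign p)
    (fun z => ⟨hs.trans (hu z).1, (hu z).2.trans ht⟩) ξ _

lemma ae_bounded_of_summable_integral {Ω : Type*} [MeasurableSpace Ω] {μ : Measure Ω}
    {ι : Type*} [Countable ι] {f : ι → Ω → ℝ} {b : ι → ℝ} (hf0 : ∀ i x, 0 ≤ f i x)
    (hfi : ∀ i, Integrable (f i) μ) (hfb : ∀ i, ∫ x, f i x ∂μ ≤ b i) (hb : Summable b) :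
    ∀ᵐ x ∂μ, ∃ A : ℝ, 0 ≤ A ∧ ∀ i, f i x ≤ A := by
  have hlt : ∫⁻ x, ∑' i, ENNReal.ofReal (f i x) ∂μ ≠ ⊤ := by
    rw [lintegral_tsum fun i => (hfi i).aestronglyMeasurable.aemeasurable.ennreal_ofReal]
    refine ne_top_of_le_ne_top (ENNReal.ofReal_ne_top (r := ∑' i, b i)) ?_
    have hb0 : ∀ i, 0 ≤ b i := fun i => (integral_nonneg (hf0 i)).trans (hfb i)
    rw [ENNReal.ofReal_tsum_of_nonneg hb0 hb]
    refine ENNReal.tsum_le_tsum fun i => ?_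
    rw [← ofReal_integral_eq_lintegral_ofReal (hfi i) (Eventually.of_forall (hf0 i))]
    exact ENNReal.ofReal_le_ofReal (hfb i)
  have hae := ae_lt_top' (AEMeasurable.tsum fun i =>
    (hfi i).aestronglyMeasurable.aemeasurable.ennreal_ofReal) hlt
  filter_upwards [hae] with x hx
  refine ⟨(∑' i, ENNReal.ofReal (f i x)).toReal, ENNReal.toReal_nonneg, fun i => ?_⟩
  have := ENNReal.toReal_mono hx.ne (ENNReal.le_tsum (f := fun i => ENNReal.ofReal (f i x)) i)
  rwa [ENNReal.toReal_ofReal (hf0 i x)] at this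

lemma exists_integral_norm_Yint_pow_le_japanese {Ω : Type*} [MeasureSpace Ω]
    [IsProbabilityMeasure (volume : Measure Ω)] {d : ℕ} {H : ℝ} (hH : 0 < H) (hH1 : H < 1)
    {W : Ω → ℝ → Euc d} (hW : IsFBM d H W) (hc : ∀ x, Continuous (W x)) {p : ℕ} (hp : 0 < p)
    (q : ℕ) :
    ∃ C : ℝ, 0 ≤ C ∧ ∀ (s t ω : ℝ) (ξ : Euc d), 0 ≤ s → s ≤ t → t ≤ 1 →
      ∫ x : Ω, ‖Yint (W x) s t ω ξ‖ ^ (2 * p + q) ≤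
        C * (t - s) ^ (p + q) * (1 + ‖ξ‖) ^ (-(p : ℝ) / H) := by
  obtain ⟨C, hC, hbound⟩ := exists_integral_norm_Yint_pow_le hH hH1 hW hc hp
  refine ⟨2 ^ ((p : ℝ) / H) * (C + 1), by positivity, fun s t ω ξ hs hst ht => ?_⟩
  have hts : 0 ≤ t - s := by linarith
  have hint : ∀ n : ℕ, Integrable fun x : Ω => ‖Yint (W x) s t ω ξ‖ ^ n := fun n =>
    Integrable.of_bound (C := (t - s) ^ n)
      ((measurable_Yint hW hc s t ω ξ).norm.pow_const n).aestronglyMeasurable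
      (Eventually.of_forall fun x => by
        rw [Real.norm_of_nonneg (by positivity)]
        exact pow_le_pow_left₀ (norm_nonneg _) (norm_Yint_le _ hst _ _) n)
  have hexp : 0 ≤ (p : ℝ) / H := by positivity
  have hmain : ∫ x : Ω, ‖Yint (W x) s t ω ξ‖ ^ (2 * p) ≤
      2 ^ ((p : ℝ) / H) * (C + 1) * (t - s) ^ p * (1 + ‖ξ‖) ^ (-(p : ℝ) / H) := by
    rw [neg_div]
    rcases lt_or_ge ‖ξ‖ 1 with h1 | h1
    · have h2 : ∫ x : Ω, ‖Yint (W x) s t ω ξ‖ ^ (2 * p) ≤ (t - s) ^ p := by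
        calc _ ≤ ∫ _ : Ω, (t - s) ^ p := by
              refine integral_mono (hint _) (integrable_const _) fun x => ?_
              calc ‖Yint (W x) s t ω ξ‖ ^ (2 * p) ≤ (t - s) ^ (2 * p) :=
                    pow_le_pow_left₀ (norm_nonneg _) (norm_Yint_le _ hst _ _) _
                _ ≤ (t - s) ^ p := pow_le_pow_of_le_one hts (by linarith) (by omega)
          _ = _ := by simp
      refine h2.trans ?_
      have h3 : 1 ≤ 2 ^ ((p : ℝ) / H) * (1 + ‖ξ‖) ^ (-((p : ℝ) / H)) := by
        rw [Real.rpow_neg (by positivity), ← div_eq_mul_inv,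
          ← Real.div_rpow (by norm_num) (by positivity)]
        exact Real.one_le_rpow (by rw [le_div_iff₀ (by positivity)]; linarith) hexp
      calc (t - s) ^ p = 1 * 1 * (t - s) ^ p := by ring
        _ ≤ (2 ^ ((p : ℝ) / H) * (1 + ‖ξ‖) ^ (-((p : ℝ) / H))) * (C + 1) * (t - s) ^ p := by
            gcongr; linarith
        _ = _ := by ring
    · have hξ : ξ ≠ 0 := fun h => by rw [h, norm_zero] at h1; linarith
      refine (hbound s t ω ξ hs hst ht hξ).trans ?_
      rw [neg_div]
      have h3 : ‖ξ‖ ^ (-((p : ℝ) / H)) ≤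
          2 ^ ((p : ℝ) / H) * (1 + ‖ξ‖) ^ (-((p : ℝ) / H)) := by
        have h4 : (2 : ℝ) ^ ((p : ℝ) / H) = (2⁻¹ : ℝ) ^ (-((p : ℝ) / H)) := by
          rw [Real.rpow_neg (by norm_num), Real.inv_rpow (by norm_num), inv_inv]
        rw [h4, ← Real.mul_rpow (by norm_num) (by positivity)]
        exact Real.rpow_le_rpow_of_nonpos (by positivity) (by linarith) (by linarith)
      calc C * (t - s) ^ p * ‖ξ‖ ^ (-((p : ℝ) / H))
          ≤ (C + 1) * (t - s) ^ p * (2 ^ ((p : ℝ) / H) * (1 + ‖ξ‖) ^ (-((p : ℝ) / H))) := by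
            gcongr; linarith
        _ = _ := by ring
  calc ∫ x : Ω, ‖Yint (W x) s t ω ξ‖ ^ (2 * p + q)
      ≤ ∫ x : Ω, (t - s) ^ q * ‖Yint (W x) s t ω ξ‖ ^ (2 * p) := by
        refine integral_mono (hint _) ((hint _).const_mul _) fun x => ?_
        simp only
        rw [pow_add, mul_comm]
        have := pow_le_pow_left₀ (norm_nonneg _) (norm_Yint_le (W x) hst ω ξ) q
        gcongr
    _ = (t - s) ^ q * ∫ x : Ω, ‖Yint (W x) s t ω ξ‖ ^ (2 * p) := integral_const_mul _ _
    _ ≤ (t - s) ^ q * (2 ^ ((p : ℝ) / H) * (C + 1) * (t - s) ^ p *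
          (1 + ‖ξ‖) ^ (-(p : ℝ) / H)) := by gcongr
    _ = _ := by rw [pow_add]; ring

lemma euclidean_norm_le_sum {d : ℕ} (v : Euc d) : ‖v‖ ≤ ∑ i, |v i| := by
  rw [EuclideanSpace.norm_eq]
  refine Real.sqrt_le_iff.2 ⟨Finset.sum_nonneg fun i _ => abs_nonneg _, ?_⟩
  exact Finset.sum_sq_le_sq_sum_of_nonneg fun i _ => norm_nonneg _

lemma IsFBM.map_increment {Ω : Type*} [MeasureSpace Ω] {d : ℕ} {H : ℝ} (hH : 0 < H)
    {W : Ω → ℝ → Euc d} (hW : IsFBM d H W) {s t : ℝ} (hs : s ∈ Set.Icc (0 : ℝ) 1)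
    (ht : t ∈ Set.Icc (0 : ℝ) 1) (i : Fin d) :
    Measure.map (fun x => W x t i - W x s i) (volume : Measure Ω) =
      ProbabilityTheory.gaussianReal 0 (|t - s| ^ (2 * H)).toNNReal := by
  have h := hW.2.2.2 2 ![1, -1] ![t, s] (fun _ => i) (fun k => by fin_cases k <;> assumption)
  have h0 : (0 : ℝ) ^ (2 * H) = 0 := Real.zero_rpow (by positivity)
  simp only [Fin.sum_univ_two, Matrix.cons_val_zero, Matrix.cons_val_one, if_true, fbmCov,
    sub_self, abs_zero, h0, abs_sub_comm s t] at h
  convert h using 2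
  · ext x; ring
  · congr 1; ring

lemma IsFBM.exists_integral_increment_pow_le {Ω : Type*} [MeasureSpace Ω] {d : ℕ} {H : ℝ}
    (hH : 0 < H) {W : Ω → ℝ → Euc d} (hW : IsFBM d H W) (n : ℕ) :
    ∃ C : ℝ, 0 ≤ C ∧ ∀ s ∈ Set.Icc (0 : ℝ) 1, ∀ t ∈ Set.Icc (0 : ℝ) 1, ∀ i : Fin d,
      Integrable (fun x : Ω => |W x t i - W x s i| ^ n) ∧
      ∫ x : Ω, |W x t i - W x s i| ^ n = C * (|t - s| ^ H) ^ n := by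
  refine ⟨∫ y, |y| ^ n ∂(ProbabilityTheory.gaussianReal 0 1), integral_nonneg fun y => by positivity,
    fun s hs t ht i => ?_⟩
  have hmeas : Measurable fun x : Ω => W x t i - W x s i := by
    have h1 : ∀ r, Measurable fun x : Ω => W x r i := fun r =>
      (EuclideanSpace.proj i : Euc d →L[ℝ] ℝ).continuous.measurable.comp (hW.2.1 r)
    exact (h1 t).sub (h1 s)
  have hlaw : Measure.map (fun x => W x t i - W x s i) (volume : Measure Ω) =
      (ProbabilityTheory.gaussianReal 0 1).map (|t - s| ^ H * ·) := by
    rw [hW.map_increment hH hs ht i, ProbabilityTheory.gaussianReal_map_const_mul]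
    congr 1
    · simp
    · ext
      rw [Real.coe_toNNReal _ (by positivity)]
      simp only [mul_one, NNReal.coe_mk]
      rw [← Real.rpow_natCast, ← Real.rpow_mul (abs_nonneg _), mul_comm H]
      norm_num
  have hint : Integrable (fun y : ℝ => |y| ^ n) (ProbabilityTheory.gaussianReal 0 1) :=
    (ProbabilityTheory.memLp_id_gaussianReal (μ := 0) (v := 1) n).integrable_norm_pow'
  have hcomp : ∀ y : ℝ, |(|t - s| ^ H * y)| ^ n = (|t - s| ^ H) ^ n * |y| ^ n := fun y => by
    rw [abs_mul, abs_of_nonneg (by positivity : 0 ≤ |t - s| ^ H), mul_pow]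
  have hm : Measurable fun y : ℝ => |y| ^ n := by fun_prop
  constructor
  · have : Integrable (fun y : ℝ => |y| ^ n)
        (Measure.map (fun x => W x t i - W x s i) (volume : Measure Ω)) := by
      rw [hlaw, integrable_map_measure hm.aestronglyMeasurable (by fun_prop)]
      simp only [Function.comp_def, hcomp]
      exact hint.const_mul _
    exact this.comp_measurable hmeas
  · calc ∫ x : Ω, |W x t i - W x s i| ^ n
        = ∫ y, |y| ^ n ∂(Measure.map (fun x => W x t i - W x s i) (volume : Measure Ω)) :=
          (integral_map hmeas.aemeasurable hm.aestronglyMeasurable).symm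
      _ = _ := by
          rw [hlaw, integral_map (by fun_prop) hm.aestronglyMeasurable]
          simp only [hcomp]
          rw [integral_const_mul, mul_comm]

lemma dyadic_mem_Icc {m k : ℕ} (hk : k ≤ 2 ^ m) : (k : ℝ) / 2 ^ m ∈ Set.Icc (0 : ℝ) 1 :=
  ⟨by positivity, (div_le_one (by positivity)).2 (by exact_mod_cast hk)⟩

/-- Sample paths of the fractional Brownian motion are almost surely Hölder continuous. -/
lemma IsFBM.ae_holder {Ω : Type*} [MeasureSpace Ω] {d : ℕ} {H : ℝ}
    (hH : 0 < H) {W : Ω → ℝ → Euc d} (hW : IsFBM d H W) :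
    ∀ᵐ x : Ω, ∃ A : ℝ, 0 ≤ A ∧ ∀ s t : ℝ, 0 ≤ s → s < t → t ≤ 1 →
      ‖W x t - W x s‖ ≤ A * (t - s) ^ (H / 2) := by
  obtain ⟨Q, hQ⟩ := exists_nat_gt (4 / H)
  have hQH : 2 ≤ H / 2 * Q := by
    rw [div_lt_iff₀ hH] at hQ; linarith
  have hQ0 : Q ≠ 0 := by
    rintro rfl
    norm_num at hQH
  obtain ⟨C, hC, hmom⟩ := hW.exists_integral_increment_pow_le hH Q
  obtain ⟨C', hC', hhol⟩ := holder_of_dyadic (half_pos hH)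
  let Z : ℕ → ℕ → Fin d → Ω → ℝ := fun m k i x =>
    |W x (((k : ℝ) + 1) / 2 ^ m) i - W x ((k : ℝ) / 2 ^ m) i| / (((2 : ℝ) ^ m)⁻¹) ^ (H / 2)
  have hZ0 : ∀ m k i x, 0 ≤ Z m k i x := fun m k i x => by positivity
  have hZi : ∀ m k i, k < 2 ^ m → Integrable (fun x => Z m k i x ^ Q) ∧
      ∫ x, Z m k i x ^ Q ≤ C * (((2 : ℝ) ^ m)⁻¹) ^ 2 := by
    intro m k i hk
    have h1 := hmom _ (dyadic_mem_Icc hk.le) _ (dyadic_mem_Icc (Nat.succ_le_of_lt hk)) i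
    push_cast at h1
    have hd : ((k : ℝ) + 1) / 2 ^ m - (k : ℝ) / 2 ^ m = ((2 : ℝ) ^ m)⁻¹ := by ring
    have hδ : (0 : ℝ) < ((2 : ℝ) ^ m)⁻¹ := by positivity
    have hδ1 : ((2 : ℝ) ^ m)⁻¹ ≤ 1 := inv_le_one_of_one_le₀ (one_le_pow₀ (by norm_num))
    rw [hd, abs_of_pos hδ] at h1
    simp only [Z, div_pow]
    refine ⟨h1.1.div_const _, ?_⟩
    rw [integral_div, h1.2, mul_div_assoc]
    gcongr
    rw [← div_pow, ← Real.rpow_sub hδ, ← Real.rpow_natCast, ← Real.rpow_mul hδ.le,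
      ← Real.rpow_natCast _ 2]
    exact Real.rpow_le_rpow_of_exponent_ge hδ hδ1 (by push_cast; linarith)
  have hae := ae_bounded_of_summable_integral (μ := (volume : Measure Ω))
    (f := fun (m : ℕ) x => ∑ k ∈ Finset.range (2 ^ m), ∑ i, Z m k i x ^ Q)
    (b := fun m => (d * C) * (1 / 2 : ℝ) ^ m)
    (fun m x => Finset.sum_nonneg fun k _ => Finset.sum_nonneg fun i _ => pow_nonneg (hZ0 _ _ _ _) _)
    (fun m => integrable_finsetSum _ fun k hk => integrable_finsetSum _ fun i _ =>
      (hZi m k i (Finset.mem_range.1 hk)).1)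
    (fun m => by
      rw [integral_finsetSum _ fun k hk => integrable_finsetSum _ fun i _ =>
        (hZi m k i (Finset.mem_range.1 hk)).1]
      calc _ ≤ ∑ k ∈ Finset.range (2 ^ m), ∑ i : Fin d, C * (((2 : ℝ) ^ m)⁻¹) ^ 2 := by
            refine Finset.sum_le_sum fun k hk => ?_
            rw [integral_finsetSum _ fun i _ => (hZi m k i (Finset.mem_range.1 hk)).1]
            exact Finset.sum_le_sum fun i _ => (hZi m k i (Finset.mem_range.1 hk)).2
        _ = _ := by
            simp only [Finset.sum_const, Finset.card_range, Finset.card_univ, Fintype.card_fin,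
              nsmul_eq_mul]
            push_cast
            have h1 : ((2 : ℝ) ^ m)⁻¹ = (1 / 2) ^ m := by rw [one_div, inv_pow]
            have h2 : (2 : ℝ) ^ m * (1 / 2) ^ m = 1 := by rw [← mul_pow]; norm_num
            rw [h1]
            linear_combination (d * C * (1 / 2) ^ m) * h2)
    ((summable_geometric_of_lt_one (by norm_num) (by norm_num)).mul_left _)
  filter_upwards [hae] with x ⟨A, hA, hb⟩
  refine ⟨C' * (d * (A + 1)), by positivity, fun s t hs hst ht => ?_⟩
  refine hhol (W x) (d * (A + 1)) (hW.1 x) (by positivity) (fun m k hk => ?_) s t hs hst ht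
  refine (euclidean_norm_le_sum _).trans ?_
  have hZA : ∀ i, Z m k i x ≤ A + 1 := by
    intro i
    rcases le_total (Z m k i x) 1 with h1 | h1
    · linarith
    · have h2 : Z m k i x ≤ Z m k i x ^ Q := le_self_pow₀ h1 hQ0
      have h3 : Z m k i x ^ Q ≤ ∑ k ∈ Finset.range (2 ^ m), ∑ i, Z m k i x ^ Q :=
        (Finset.single_le_sum (f := fun i => Z m k i x ^ Q)
          (fun i _ => pow_nonneg (hZ0 _ _ _ _) _) (Finset.mem_univ i)).trans
        (Finset.single_le_sum (f := fun k => ∑ i, Z m k i x ^ Q)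
          (fun k _ => Finset.sum_nonneg fun i _ => pow_nonneg (hZ0 _ _ _ _) _)
          (Finset.mem_range.2 hk))
      linarith [hb m]
  calc ∑ i, |(W x (((k : ℝ) + 1) / 2 ^ m) - W x ((k : ℝ) / 2 ^ m)) i|
      ≤ ∑ i : Fin d, (A + 1) * (((2 : ℝ) ^ m)⁻¹) ^ (H / 2) := by
        refine Finset.sum_le_sum fun i _ => ?_
        rw [PiLp.sub_apply]
        exact (div_le_iff₀ (by positivity)).1 (hZA i)
    _ = _ := by
        simp only [Finset.sum_const, Finset.card_univ, Fintype.card_fin, nsmul_eq_mul]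
        ring

/-- The integrand of `Yint`. -/
def Yker {d : ℕ} (w : ℝ → Euc d) (ω : ℝ) (ξ : Euc d) (u : ℝ) : ℂ :=
  Complex.exp (Complex.I * ((inner ℝ ξ (w u) + ω * u : ℝ) : ℂ))

lemma Yint_eq {d : ℕ} (w : ℝ → Euc d) (s t ω : ℝ) (ξ : Euc d) :
    Yint w s t ω ξ = ∫ u in s..t, Yker w ω ξ u := rfl

lemma continuous_Yker {d : ℕ} {w : ℝ → Euc d} (hw : Continuous w) (ω : ℝ) (ξ : Euc d) :
    Continuous (Yker w ω ξ) := by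
  unfold Yker; fun_prop

lemma Yint_add {d : ℕ} {w : ℝ → Euc d} (hw : Continuous w) (r s t ω : ℝ) (ξ : Euc d) :
    Yint w r s ω ξ + Yint w s t ω ξ = Yint w r t ω ξ := by
  simp only [Yint_eq]
  exact intervalIntegral.integral_add_adjacent_intervals
    ((continuous_Yker hw ω ξ).intervalIntegrable _ _)
    ((continuous_Yker hw ω ξ).intervalIntegrable _ _)

lemma norm_exp_I_mul_sub_le (a b : ℝ) :
    ‖Complex.exp (Complex.I * (a : ℂ)) - Complex.exp (Complex.I * (b : ℂ))‖ ≤ |a - b| := by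
  have h : Complex.exp (Complex.I * (a : ℂ)) - Complex.exp (Complex.I * (b : ℂ)) =
      Complex.exp (Complex.I * (b : ℂ)) * (Complex.exp (Complex.I * ((a - b : ℝ) : ℂ)) - 1) := by
    rw [mul_sub, ← Complex.exp_add, mul_one]
    congr 2
    push_cast; ring
  rw [h, norm_mul, Complex.norm_exp_I_mul_ofReal, one_mul]
  exact Real.norm_exp_I_mul_ofReal_sub_one_le

lemma exp_I_mul_add_pi_div {ω : ℝ} (hω : ω ≠ 0) (a : ℝ) :
    Complex.exp (Complex.I * ((a + ω * (Real.pi / |ω|) : ℝ) : ℂ)) =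
      -Complex.exp (Complex.I * (a : ℂ)) := by
  have h : Complex.exp (Complex.I * ((ω * (Real.pi / |ω|) : ℝ) : ℂ)) = -1 := by
    rcases lt_or_gt_of_ne hω with h | h
    · rw [abs_of_neg h, show ω * (Real.pi / -ω) = -Real.pi by field_simp]
      push_cast
      rw [mul_neg, Complex.exp_neg, mul_comm, Complex.exp_pi_mul_I]; norm_num
    · rw [abs_of_pos h, show ω * (Real.pi / ω) = Real.pi by field_simp, mul_comm,
        Complex.exp_pi_mul_I]
  rw [Complex.ofReal_add, mul_add, Complex.exp_add, h]
  ring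

/-- Oscillation in time makes `Y` small for large `ω`, for Hölder continuous paths. -/
lemma norm_Yint_le_of_holder {d : ℕ} {w : ℝ → Euc d} (hw : Continuous w) {A h : ℝ} (hA : 0 ≤ A)
    (hh : 0 < h) (hh1 : h ≤ 1)
    (hhol : ∀ s t : ℝ, 0 ≤ s → s < t → t ≤ 1 → ‖w t - w s‖ ≤ A * (t - s) ^ h)
    {s t ω : ℝ} (hs : 0 ≤ s) (hst : s ≤ t) (ht : t ≤ 1) (hω : ω ≠ 0) (ξ : Euc d) :
    ‖Yint w s t ω ξ‖ ≤ (1 + A) * (1 + ‖ξ‖) * (Real.pi / |ω|) ^ h := by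
  set τ := Real.pi / |ω| with hτ
  have hτ0 : 0 < τ := div_pos Real.pi_pos (abs_pos.2 hω)
  have hone : 1 ≤ (1 + A) * (1 + ‖ξ‖) := by nlinarith [norm_nonneg ξ]
  have htriv := norm_Yint_le w hst ω ξ
  have hτh : 0 < τ ^ h := Real.rpow_pos_of_pos hτ0 h
  rcases le_total 1 τ with h1 | h1
  · have := Real.one_le_rpow h1 hh.le
    nlinarith
  have hττ : τ ≤ τ ^ h := by
    conv_lhs => rw [← Real.rpow_one τ]
    exact Real.rpow_le_rpow_of_exponent_ge hτ0 h1 hh1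
  rcases le_total (t - s) τ with h2 | h2
  · nlinarith
  have hshift : Yint w (s + τ) t ω ξ = ∫ u in s..(t - τ), Yker w ω ξ (u + τ) := by
    rw [Yint_eq, intervalIntegral.integral_comp_add_right, sub_add_cancel]
  have hc := continuous_Yker hw ω ξ
  have hsum : ‖Yint w s (t - τ) ω ξ + Yint w (s + τ) t ω ξ‖ ≤ ‖ξ‖ * (A * τ ^ h) := by
    have hc' : Continuous fun u => Yker w ω ξ (u + τ) := hc.comp (continuous_add_const τ)
    rw [hshift, Yint_eq, ← intervalIntegral.integral_add (hc.intervalIntegrable _ _)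
      (hc'.intervalIntegrable _ _)]
    have hb := intervalIntegral.norm_integral_le_of_norm_le_const (a := s) (b := t - τ)
      (C := ‖ξ‖ * (A * τ ^ h)) (f := fun u => Yker w ω ξ u + Yker w ω ξ (u + τ)) (by
        intro u hu
        rw [Set.uIoc_of_le (by linarith)] at hu
        have e1 : Yker w ω ξ (u + τ) =
            -Complex.exp (Complex.I * ((inner ℝ ξ (w (u + τ)) + ω * u : ℝ) : ℂ)) := by
          rw [← exp_I_mul_add_pi_div hω, Yker]
          congr 3
          ring
        rw [e1, ← sub_eq_add_neg, Yker]
        refine (norm_exp_I_mul_sub_le _ _).trans ?_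
        rw [add_sub_add_right_eq_sub, ← inner_sub_right, ← abs_neg, ← inner_neg_right, neg_sub]
        have h3 := hhol u (u + τ) (by linarith [hu.1]) (by linarith) (by linarith [hu.2])
        rw [add_sub_cancel_left] at h3
        refine (abs_real_inner_le_norm _ _).trans ?_
        gcongr)
    refine hb.trans ?_
    rw [abs_of_nonneg (by linarith)]
    have : 0 ≤ ‖ξ‖ * (A * τ ^ h) := by positivity
    nlinarith
  have e1 := Yint_add hw s (t - τ) t ω ξ
  have e2 := Yint_add hw s (s + τ) t ω ξ
  have hY : 2 * Yint w s t ω ξ = (Yint w s (t - τ) ω ξ + Yint w (s + τ) t ω ξ) +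
      Yint w (t - τ) t ω ξ + Yint w s (s + τ) ω ξ := by
    linear_combination -e1 - e2
  have b1 := norm_Yint_le w (by linarith : t - τ ≤ t) ω ξ
  have b2 := norm_Yint_le w (by linarith : s ≤ s + τ) ω ξ
  have hn : 2 * ‖Yint w s t ω ξ‖ ≤ ‖ξ‖ * (A * τ ^ h) + τ + τ := by
    have : 2 * ‖Yint w s t ω ξ‖ = ‖2 * Yint w s t ω ξ‖ := by simp
    rw [this, hY]
    refine (norm_add₃_le).trans ?_
    linarith
  have h5 : (1 + A) * (1 + ‖ξ‖) * τ ^ h =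
    τ ^ h + A * τ ^ h + ‖ξ‖ * τ ^ h + ‖ξ‖ * (A * τ ^ h) := by ring
  have : 0 ≤ ‖ξ‖ * (A * τ ^ h) := by positivity
  have : 0 ≤ ‖ξ‖ * τ ^ h := by positivity
  have : 0 ≤ A * τ ^ h := by positivity
  rw [h5]
  linarith

lemma norm_Yint_le_of_large_frequency {d : ℕ} {w : ℝ → Euc d} (hw : Continuous w) {A h α γ M : ℝ}
    (hA : 0 ≤ A) (hh : 0 < h) (hh1 : h ≤ 1)
    (hhol : ∀ s t : ℝ, 0 ≤ s → s < t → t ≤ 1 → ‖w t - w s‖ ≤ A * (t - s) ^ h)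
    (hγ : 0 < γ) (hγ1 : γ < 1) (hM : -α ≤ (M * h - 1) * (1 - γ))
    {s t ω : ℝ} (hs : 0 ≤ s) (hst : s < t) (ht : t ≤ 1) (ξ : Euc d)
    (hω : (1 + ‖ξ‖) ^ M ≤ |ω|) :
    ‖Yint w s t ω ξ‖ ≤ ((1 + A) * Real.pi ^ h) ^ (1 - γ) * (1 + ‖ξ‖) ^ α * (t - s) ^ γ := by
  have hx : 0 < 1 + ‖ξ‖ := by positivity
  have hx1 : 1 ≤ 1 + ‖ξ‖ := by linarith [norm_nonneg ξ]
  have hxM : 0 < (1 + ‖ξ‖) ^ M := Real.rpow_pos_of_pos hx M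
  have hω0 : 0 < |ω| := hxM.trans_le hω
  have h1 := norm_Yint_le_of_holder hw hA hh hh1 hhol hs hst.le ht (abs_pos.1 hω0) ξ
  have h2 : ‖Yint w s t ω ξ‖ ≤ (1 + A) * Real.pi ^ h * (1 + ‖ξ‖) ^ (1 - M * h) := by
    refine h1.trans ?_
    have h3 : (Real.pi / |ω|) ^ h ≤ Real.pi ^ h * (1 + ‖ξ‖) ^ (-(M * h)) := by
      rw [Real.rpow_neg hx.le, Real.rpow_mul hx.le, ← div_eq_mul_inv,
        ← Real.div_rpow Real.pi_pos.le hxM.le]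
      have := Real.pi_pos
      gcongr
    calc (1 + A) * (1 + ‖ξ‖) * (Real.pi / |ω|) ^ h
        ≤ (1 + A) * (1 + ‖ξ‖) * (Real.pi ^ h * (1 + ‖ξ‖) ^ (-(M * h))) := by gcongr
      _ = (1 + A) * Real.pi ^ h * ((1 + ‖ξ‖) ^ (1 : ℝ) * (1 + ‖ξ‖) ^ (-(M * h))) := by
          rw [Real.rpow_one]; ring
      _ = _ := by rw [← Real.rpow_add hx, sub_eq_add_neg]
  have hπ : 0 < Real.pi ^ h := Real.rpow_pos_of_pos Real.pi_pos h
  calc ‖Yint w s t ω ξ‖ = ‖Yint w s t ω ξ‖ ^ (1 - γ) * ‖Yint w s t ω ξ‖ ^ γ := by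
        rw [← Real.rpow_add_of_nonneg (norm_nonneg _) (by linarith) hγ.le, sub_add_cancel,
          Real.rpow_one]
    _ ≤ ((1 + A) * Real.pi ^ h * (1 + ‖ξ‖) ^ (1 - M * h)) ^ (1 - γ) * (t - s) ^ γ := by
        have h4 := norm_Yint_le w hst.le ω ξ
        have h5 : 0 ≤ 1 - γ := by linarith
        gcongr
    _ ≤ _ := by
        rw [Real.mul_rpow (by positivity) (by positivity), ← Real.rpow_mul hx.le]
        have h6 : 0 ≤ (t - s) ^ γ := Real.rpow_nonneg (by linarith) γ
        have h7 : (1 + ‖ξ‖) ^ ((1 - M * h) * (1 - γ)) ≤ (1 + ‖ξ‖) ^ α :=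
          Real.rpow_le_rpow_of_exponent_le hx1 (by nlinarith)
        gcongr

lemma exists_integral_normalized_pow_le {Ω : Type*} [MeasureSpace Ω]
    [IsProbabilityMeasure (volume : Measure Ω)] {d : ℕ} {H : ℝ} (hH : 0 < H) (hH1 : H < 1)
    {W : Ω → ℝ → Euc d} (hW : IsFBM d H W) (hc : ∀ x, Continuous (W x)) {α : ℝ} {L : ℕ}
    (hL : 0 < L) (hLα : 1 ≤ L * (1 / H + 2 * α) + α) {m : ℕ} (hm : 8 ≤ m) :
    ∃ C : ℝ, 0 ≤ C ∧ ∀ (N : ℕ) (s t ω : ℝ) (ξ : Euc d), 1 ≤ N → 0 ≤ s → s < t → t ≤ 1 →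
      (N : ℝ) ≤ (1 + d) * (1 + ‖ξ‖) →
      ∫ x : Ω, (‖Yint (W x) s t ω ξ‖ / ((t - s) ^ ((L + 3 / 4 : ℝ) / (2 * L + 1)) * (N : ℝ) ^ α)) ^
        ((2 * L + 1) * m) ≤ C * ((t - s) ^ 2 * ((N : ℝ) ^ m)⁻¹) := by
  obtain ⟨C, hC, hb⟩ := exists_integral_norm_Yint_pow_le_japanese hH hH1 hW hc
    (p := m * L) (Nat.mul_pos (by omega) hL) m
  refine ⟨C * (1 + d) ^ ((m * L : ℕ) / H : ℝ), by positivity, fun N s t ω ξ hN hs hst ht hNξ => ?_⟩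
  have hN1 : (1 : ℝ) ≤ N := by exact_mod_cast hN
  have hN0 : (0 : ℝ) < N := by linarith
  have hts : 0 < t - s := by linarith
  have hts1 : t - s ≤ 1 := by linarith
  have hm' : (8 : ℝ) ≤ m := by exact_mod_cast hm
  have h1 := hb s t ω ξ hs hst.le ht
  rw [show 2 * (m * L) + m = (2 * L + 1) * m by ring] at h1
  simp only [div_pow]
  rw [integral_div]
  have hD : 0 < ((t - s) ^ ((L + 3 / 4 : ℝ) / (2 * L + 1)) * (N : ℝ) ^ α) ^ ((2 * L + 1) * m) := by
    positivity
  rw [div_le_iff₀ hD]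
  refine h1.trans ?_
  have e1 : ((t - s) ^ ((L + 3 / 4 : ℝ) / (2 * L + 1)) * (N : ℝ) ^ α) ^ ((2 * L + 1) * m) =
      (t - s) ^ ((L + 3 / 4 : ℝ) * m) * (N : ℝ) ^ (α * ((2 * L + 1) * m)) := by
    rw [mul_pow, ← Real.rpow_natCast, ← Real.rpow_mul hts.le, ← Real.rpow_natCast,
      ← Real.rpow_mul hN0.le]
    congr 2
    · push_cast; field_simp
    · push_cast; ring
  have e2 : (t - s) ^ (m * L + m) ≤ (t - s) ^ 2 * (t - s) ^ ((L + 3 / 4 : ℝ) * m) := by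
    rw [← Real.rpow_natCast, ← Real.rpow_natCast _ 2, ← Real.rpow_add hts]
    refine Real.rpow_le_rpow_of_exponent_ge hts hts1 ?_
    push_cast
    nlinarith
  have e3 : (1 + ‖ξ‖) ^ (-((m * L : ℕ) : ℝ) / H) ≤
      (1 + d) ^ ((m * L : ℕ) / H : ℝ) * (((N : ℝ) ^ m)⁻¹ * (N : ℝ) ^ (α * ((2 * L + 1) * m))) := by
    have hx : (N : ℝ) / (1 + d) ≤ 1 + ‖ξ‖ := by
      rw [div_le_iff₀ (by positivity)]; linarith
    have hneg : -((m * L : ℕ) : ℝ) / H ≤ 0 := by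
      rw [neg_div]; have : 0 ≤ ((m * L : ℕ) : ℝ) / H := by positivity
      linarith
    calc (1 + ‖ξ‖) ^ (-((m * L : ℕ) : ℝ) / H)
        ≤ ((N : ℝ) / (1 + d)) ^ (-((m * L : ℕ) : ℝ) / H) :=
          Real.rpow_le_rpow_of_nonpos (by positivity) hx hneg
      _ = (1 + d) ^ ((m * L : ℕ) / H : ℝ) * (N : ℝ) ^ (-((m * L : ℕ) : ℝ) / H) := by
          rw [Real.div_rpow hN0.le (by positivity), neg_div, Real.rpow_neg (by positivity),
            Real.rpow_neg (by positivity)]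
          field_simp
      _ ≤ _ := by
          rw [← Real.rpow_natCast (N : ℝ) m, ← Real.rpow_neg hN0.le, ← Real.rpow_add hN0]
          refine mul_le_mul_of_nonneg_left (Real.rpow_le_rpow_of_exponent_le hN1 ?_)
            (by positivity)
          have h3 := mul_le_mul_of_nonneg_left hLα (by linarith : (0 : ℝ) ≤ m)
          have h4 : -((m * L : ℕ) : ℝ) / H = -((m : ℝ) * (L * (1 / H))) := by
            push_cast; ring
          rw [h4]
          linarith
  rw [e1]
  calc C * (t - s) ^ (m * L + m) * (1 + ‖ξ‖) ^ (-((m * L : ℕ) : ℝ) / H)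
      ≤ C * ((t - s) ^ 2 * (t - s) ^ ((L + 3 / 4 : ℝ) * m)) * ((1 + d) ^ ((m * L : ℕ) / H : ℝ) *
          (((N : ℝ) ^ m)⁻¹ * (N : ℝ) ^ (α * ((2 * L + 1) * m)))) := by
        gcongr
    _ = _ := by ring

/-- The point of the lattice of mesh `N^(-b)` with integer coordinates `q`. -/
def latticePoint {d : ℕ} (N b : ℕ) (q : Fin d → ℤ) : Euc d :=
  WithLp.toLp 2 fun i => (q i : ℝ) / (N : ℝ) ^ b

/-- Integer vectors with entries bounded by `R`. -/
def latticeBox (d R : ℕ) : Finset (ℤ × (Fin d → ℤ)) :=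
  Finset.Icc (-(R : ℤ)) R ×ˢ Fintype.piFinset fun _ => Finset.Icc (-(R : ℤ)) R

lemma card_latticeBox (d R : ℕ) : (latticeBox d R).card = (2 * R + 1) ^ (d + 1) := by
  rw [latticeBox, Finset.card_product, Fintype.card_piFinset_const, Int.card_Icc,
    pow_succ']
  have : ((R : ℤ) + 1 - -(R : ℤ)).toNat = 2 * R + 1 := by omega
  rw [this]

lemma mem_latticeBox {d R : ℕ} {q : ℤ × (Fin d → ℤ)} :
    q ∈ latticeBox d R ↔ |q.1| ≤ R ∧ ∀ i, |q.2 i| ≤ R := by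
  simp [latticeBox, abs_le]

lemma ae_dyadic_lattice_bound {Ω : Type*} [MeasureSpace Ω]
    [IsProbabilityMeasure (volume : Measure Ω)] {d : ℕ} {H : ℝ} (hH : 0 < H) (hH1 : H < 1)
    {W : Ω → ℝ → Euc d} (hW : IsFBM d H W) (hc : ∀ x, Continuous (W x)) {α : ℝ} {L : ℕ}
    (hL : 0 < L) (hLα : 1 ≤ L * (1 / H + 2 * α) + α) (b K e : ℕ) (hK : 1 ≤ K) :
    ∀ᵐ x : Ω, ∃ A : ℝ, 0 ≤ A ∧ ∀ N : ℕ, 1 ≤ N → ∀ q ∈ latticeBox d (K * N ^ e),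
      (N : ℝ) ≤ (1 + d) * (1 + ‖latticePoint N b q.2‖) → ∀ n k : ℕ, k < 2 ^ n →
      ‖Yint (W x) ((k : ℝ) / 2 ^ n) (((k : ℝ) + 1) / 2 ^ n) ((q.1 : ℝ) / (N : ℝ) ^ b)
        (latticePoint N b q.2)‖ ≤
        A * (N : ℝ) ^ α * (((2 : ℝ) ^ n)⁻¹) ^ ((L + 3 / 4 : ℝ) / (2 * L + 1)) := by
  classical
  set m := e * (d + 1) + 8 with hm
  obtain ⟨C, hC, hmom⟩ := exists_integral_normalized_pow_le hH hH1 hW hc hL hLα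
    (m := m) (by omega)
  set Q := (2 * L + 1) * m with hQ
  have hQ0 : Q ≠ 0 := by rw [hQ]; positivity
  set γ : ℝ := (L + 3 / 4 : ℝ) / (2 * L + 1) with hγ
  let Z : ℕ → ℤ × (Fin d → ℤ) → ℕ → ℕ → Ω → ℝ := fun N q n k x =>
    ‖Yint (W x) ((k : ℝ) / 2 ^ n) (((k : ℝ) + 1) / 2 ^ n) ((q.1 : ℝ) / (N : ℝ) ^ b)
        (latticePoint N b q.2)‖ / ((((2 : ℝ) ^ n)⁻¹) ^ γ * (N : ℝ) ^ α)
  let box : ℕ → Finset (ℤ × (Fin d → ℤ)) := fun N => (latticeBox d (K * N ^ e)).filter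
    fun q => (N : ℝ) ≤ (1 + d) * (1 + ‖latticePoint N b q.2‖)
  have hZ0 : ∀ N q n k x, 0 ≤ Z N q n k x := fun N q n k x => by positivity
  have hδ : ∀ n k : ℕ, ((k : ℝ) + 1) / 2 ^ n - (k : ℝ) / 2 ^ n = ((2 : ℝ) ^ n)⁻¹ := by
    intro n k; ring
  have hle : ∀ n k : ℕ, (k : ℝ) / 2 ^ n < ((k : ℝ) + 1) / 2 ^ n := by
    intro n k
    have := hδ n k
    have : (0 : ℝ) < ((2 : ℝ) ^ n)⁻¹ := by positivity
    linarith
  have hZi : ∀ N q n k, Integrable fun x => Z N q n k x ^ Q := by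
    intro N q n k
    simp only [Z, div_pow]
    refine Integrable.div_const ?_ _
    refine Integrable.of_bound (C := (((2 : ℝ) ^ n)⁻¹) ^ Q)
      ((measurable_Yint hW hc _ _ _ _).norm.pow_const Q).aestronglyMeasurable
      (Eventually.of_forall fun x => ?_)
    rw [Real.norm_of_nonneg (by positivity)]
    have := norm_Yint_le (W x) (hle n k).le ((q.1 : ℝ) / (N : ℝ) ^ b) (latticePoint N b q.2)
    rw [hδ] at this
    exact pow_le_pow_left₀ (norm_nonneg _) this Q
  have hZm : ∀ N q n k, 1 ≤ N → q ∈ box N → k < 2 ^ n →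
      ∫ x, Z N q n k x ^ Q ≤ C * ((((2 : ℝ) ^ n)⁻¹) ^ 2 * ((N : ℝ) ^ m)⁻¹) := by
    intro N q n k hN hq hk
    have h2 := (dyadic_mem_Icc (Nat.succ_le_of_lt hk)).2
    push_cast at h2
    have h1 := hmom N _ _ ((q.1 : ℝ) / (N : ℝ) ^ b) (latticePoint N b q.2) hN
      (dyadic_mem_Icc hk.le).1 (hle n k) h2 (Finset.mem_filter.1 hq).2
    rw [hδ] at h1
    exact h1
  have hsummable : Summable fun z : ℕ × ℕ =>
      ((3 * K : ℝ) ^ (d + 1) * C) * ((1 / ((z.1 + 1 : ℕ) : ℝ) ^ 2) * (1 / 2 : ℝ) ^ z.2) := by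
    refine Summable.mul_left _ ?_
    refine Summable.mul_of_nonneg
      (f := fun N : ℕ => 1 / ((N + 1 : ℕ) : ℝ) ^ 2) (g := fun n : ℕ => (1 / 2 : ℝ) ^ n)
      ((summable_nat_add_iff 1).2 (Real.summable_one_div_nat_pow.2 one_lt_two))
      (summable_geometric_of_lt_one (by norm_num) (by norm_num)) ?_ ?_
    · intro N; simp only [Pi.zero_apply]; positivity
    · intro n; simp only [Pi.zero_apply]; positivity
  have hae := ae_bounded_of_summable_integral (μ := (volume : Measure Ω))
    (f := fun (z : ℕ × ℕ) x => ∑ q ∈ box (z.1 + 1), ∑ k ∈ Finset.range (2 ^ z.2),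
      Z (z.1 + 1) q z.2 k x ^ Q)
    (fun z x => Finset.sum_nonneg fun q _ => Finset.sum_nonneg fun k _ =>
      pow_nonneg (hZ0 _ _ _ _ _) _)
    (fun z => integrable_finsetSum _ fun q _ => integrable_finsetSum _ fun k _ => hZi _ _ _ _)
    (fun z => by
      set N := z.1 + 1 with hN
      set n := z.2
      rw [integral_finsetSum _ fun q _ => integrable_finsetSum _ fun k _ => hZi _ _ _ _]
      calc _ ≤ ∑ q ∈ box N, ∑ k ∈ Finset.range (2 ^ n),
              C * ((((2 : ℝ) ^ n)⁻¹) ^ 2 * ((N : ℝ) ^ m)⁻¹) := by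
            refine Finset.sum_le_sum fun q hq => ?_
            rw [integral_finsetSum _ fun k _ => hZi _ _ _ _]
            exact Finset.sum_le_sum fun k hk =>
              hZm N q n k (by omega) hq (Finset.mem_range.1 hk)
        _ = (box N).card * (2 ^ n * (C * ((((2 : ℝ) ^ n)⁻¹) ^ 2 * ((N : ℝ) ^ m)⁻¹))) := by
            simp only [Finset.sum_const, Finset.card_range, nsmul_eq_mul]
            push_cast; ring
        _ ≤ ((3 * K : ℝ) ^ (d + 1) * (N : ℝ) ^ (e * (d + 1))) *
              (2 ^ n * (C * ((((2 : ℝ) ^ n)⁻¹) ^ 2 * ((N : ℝ) ^ m)⁻¹))) := by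
            gcongr
            have h1 : (box N).card ≤ (2 * (K * N ^ e) + 1) ^ (d + 1) :=
              (Finset.card_filter_le _ _).trans (card_latticeBox _ _).le
            have h2 : 1 ≤ K * N ^ e := Nat.one_le_iff_ne_zero.2 (by positivity)
            have h3 : (box N).card ≤ (3 * K) ^ (d + 1) * N ^ (e * (d + 1)) := by
              refine h1.trans ?_
              rw [pow_mul, ← mul_pow]
              exact Nat.pow_le_pow_left (by linarith) _
            exact_mod_cast h3
        _ ≤ _ := by
            have hN1 : (1 : ℝ) ≤ N := by rw [hN]; push_cast; linarith [z.1.cast_nonneg (α := ℝ)]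
            have hN0 : (0 : ℝ) < N := by linarith
            have h1 : ((2 : ℝ) ^ n)⁻¹ = (1 / 2) ^ n := by rw [one_div, inv_pow]
            have h2 : (2 : ℝ) ^ n * (1 / 2) ^ n = 1 := by rw [← mul_pow]; norm_num
            have h3 : (N : ℝ) ^ (e * (d + 1)) * ((N : ℝ) ^ m)⁻¹ ≤ 1 / (N : ℝ) ^ 2 := by
              rw [hm, pow_add, mul_inv, ← mul_assoc, mul_inv_cancel₀ (by positivity), one_mul,
                one_div]
              gcongr
              norm_num
            calc _ = ((3 * K : ℝ) ^ (d + 1) * C) * (((N : ℝ) ^ (e * (d + 1)) * ((N : ℝ) ^ m)⁻¹) *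
                  ((2 ^ n * (1 / 2 : ℝ) ^ n) * (1 / 2 : ℝ) ^ n)) := by rw [h1]; ring
              _ ≤ _ := by
                  rw [h2, one_mul]
                  gcongr)
    hsummable
  filter_upwards [hae] with x ⟨A, hA, hbd⟩
  refine ⟨A + 1, by positivity, fun N hN q hq hNq n k hk => ?_⟩
  have hN0 : (0 : ℝ) < N := by exact_mod_cast hN
  have hZA : Z N q n k x ≤ A + 1 := by
    rcases le_total (Z N q n k x) 1 with h1 | h1
    · linarith
    · have h2 : Z N q n k x ≤ Z N q n k x ^ Q := le_self_pow₀ h1 hQ0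
      have h4 := hbd (N - 1, n)
      simp only [Nat.sub_add_cancel hN] at h4
      have h3 : Z N q n k x ^ Q ≤
          ∑ q ∈ box N, ∑ k ∈ Finset.range (2 ^ n), Z N q n k x ^ Q :=
        (Finset.single_le_sum (f := fun k => Z N q n k x ^ Q)
          (fun k _ => pow_nonneg (hZ0 _ _ _ _ _) _) (Finset.mem_range.2 hk)).trans
        (Finset.single_le_sum (f := fun q => ∑ k ∈ Finset.range (2 ^ n), Z N q n k x ^ Q)
          (fun q _ => Finset.sum_nonneg fun k _ => pow_nonneg (hZ0 _ _ _ _ _) _)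
          (Finset.mem_filter.2 ⟨hq, hNq⟩))
      linarith
  have := (div_le_iff₀ (by positivity)).1 hZA
  linarith

lemma norm_Yint_sub_le {d : ℕ} {w : ℝ → Euc d} (hw : Continuous w) {B : ℝ}
    (hB : ∀ u ∈ Set.Icc (0 : ℝ) 1, ‖w u‖ ≤ B) {s t : ℝ} (hs : 0 ≤ s) (hst : s ≤ t) (ht : t ≤ 1)
    (ω ω' : ℝ) (ξ ξ' : Euc d) :
    ‖Yint w s t ω ξ - Yint w s t ω' ξ'‖ ≤ (‖ξ - ξ'‖ * B + |ω - ω'|) * (t - s) := by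
  rw [Yint_eq, Yint_eq, ← intervalIntegral.integral_sub
    ((continuous_Yker hw ω ξ).intervalIntegrable _ _)
    ((continuous_Yker hw ω' ξ').intervalIntegrable _ _)]
  have h := intervalIntegral.norm_integral_le_of_norm_le_const (a := s) (b := t)
    (C := ‖ξ - ξ'‖ * B + |ω - ω'|) (f := fun u => Yker w ω ξ u - Yker w ω' ξ' u) (by
      intro u hu
      rw [Set.uIoc_of_le hst] at hu
      have hu' : u ∈ Set.Icc (0 : ℝ) 1 := ⟨hs.trans hu.1.le, hu.2.trans ht⟩
      refine (norm_exp_I_mul_sub_le _ _).trans ?_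
      have e : inner ℝ ξ (w u) + ω * u - (inner ℝ ξ' (w u) + ω' * u) =
          inner ℝ (ξ - ξ') (w u) + (ω - ω') * u := by rw [inner_sub_left]; ring
      rw [e]
      refine (abs_add_le _ _).trans ?_
      have h1 := abs_real_inner_le_norm (ξ - ξ') (w u)
      have h2 := mul_le_mul_of_nonneg_left (hB u hu') (norm_nonneg (ξ - ξ'))
      have h3 : |(ω - ω') * u| ≤ |ω - ω'| := by
        rw [abs_mul, abs_of_nonneg hu'.1]
        exact mul_le_of_le_one_right (abs_nonneg _) hu'.2
      linarith)
  rwa [abs_of_nonneg (sub_nonneg.2 hst)] at h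

lemma abs_floor_le (y : ℝ) : ((|⌊y⌋| : ℤ) : ℝ) ≤ |y| + 1 := by
  push_cast
  have h1 := Int.floor_le y
  have h2 := Int.lt_floor_add_one y
  rw [abs_le]
  constructor <;> linarith [neg_abs_le y, le_abs_self y]

lemma abs_sub_floor_div_le (y : ℝ) {c : ℝ} (hc : 0 < c) : |y - (⌊y * c⌋ : ℝ) / c| ≤ c⁻¹ := by
  have h1 := Int.floor_le (y * c)
  have h2 := Int.lt_floor_add_one (y * c)
  have e : y - (⌊y * c⌋ : ℝ) / c = (y * c - ⌊y * c⌋) * c⁻¹ := by field_simp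
  rw [e, abs_mul, abs_of_pos (inv_pos.2 hc), abs_of_nonneg (by linarith)]
  exact mul_le_of_le_one_left (inv_pos.2 hc).le (by linarith)

/-- Dyadic bounds on a lattice of frequencies control `Y` at all frequencies
`|ω| ≤ (1 + |ξ|)^M`. -/
lemma exists_norm_Yint_le_of_small_frequency {d : ℕ} {w : ℝ → Euc d} (hw : Continuous w)
    {α γ A : ℝ} (hα : α ≤ 0) (hγ : 0 < γ) (hγ1 : γ < 1) (hA : 0 ≤ A) {M b : ℕ} (hb : -α ≤ b)
    (hdy : ∀ N : ℕ, 1 ≤ N → ∀ q ∈ latticeBox d (2 ^ (M + 1) * N ^ (M + b + 1)),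
      (N : ℝ) ≤ (1 + d) * (1 + ‖latticePoint N b q.2‖) → ∀ n k : ℕ, k < 2 ^ n →
      ‖Yint w ((k : ℝ) / 2 ^ n) (((k : ℝ) + 1) / 2 ^ n) ((q.1 : ℝ) / (N : ℝ) ^ b)
        (latticePoint N b q.2)‖ ≤ A * (N : ℝ) ^ α * (((2 : ℝ) ^ n)⁻¹) ^ γ) :
    ∃ C : ℝ, 0 ≤ C ∧ ∀ (s t ω : ℝ) (ξ : Euc d), 0 ≤ s → s < t → t ≤ 1 →
      |ω| ≤ (1 + ‖ξ‖) ^ M → ‖Yint w s t ω ξ‖ ≤ C * (1 + ‖ξ‖) ^ α * (t - s) ^ γ := by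
  obtain ⟨C₁, hC₁, hhol⟩ := holder_of_dyadic hγ
  obtain ⟨B, hB⟩ := isCompact_Icc.exists_bound_of_continuousOn
    (hw.continuousOn (s := Set.Icc (0 : ℝ) 1))
  have hB0 : 0 ≤ B := (norm_nonneg _).trans (hB 0 (by simp))
  refine ⟨(C₁ * A + (d * B + 1)) * 2 ^ (-α), by positivity, fun s t ω ξ hs hst ht hω => ?_⟩
  set N := ⌊‖ξ‖⌋₊ + 1 with hN
  have hN1 : (1 : ℝ) ≤ N := by rw [hN]; push_cast; linarith [(⌊‖ξ‖⌋₊).cast_nonneg (α := ℝ)]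
  have hN0 : (0 : ℝ) < N := by linarith
  have hξN : ‖ξ‖ ≤ N := by rw [hN]; push_cast; exact (Nat.lt_floor_add_one _).le
  have hNξ : (N : ℝ) ≤ 1 + ‖ξ‖ := by
    rw [hN]; push_cast; linarith [Nat.floor_le (norm_nonneg ξ)]
  have hNb : (0 : ℝ) < (N : ℝ) ^ b := by positivity
  have hNb1 : (1 : ℝ) ≤ (N : ℝ) ^ b := one_le_pow₀ hN1
  let q : ℤ × (Fin d → ℤ) := (⌊ω * (N : ℝ) ^ b⌋, fun i => ⌊ξ i * (N : ℝ) ^ b⌋)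
  set ω' : ℝ := (q.1 : ℝ) / (N : ℝ) ^ b with hω'
  set ξ' : Euc d := latticePoint N b q.2 with hξ'
  have hωω' : |ω - ω'| ≤ ((N : ℝ) ^ b)⁻¹ := abs_sub_floor_div_le ω hNb
  have hξξ' : ‖ξ - ξ'‖ ≤ d * ((N : ℝ) ^ b)⁻¹ := by
    refine (euclidean_norm_le_sum _).trans ?_
    calc ∑ i, |(ξ - ξ') i| ≤ ∑ i : Fin d, ((N : ℝ) ^ b)⁻¹ :=
          Finset.sum_le_sum fun i _ => abs_sub_floor_div_le (ξ i) hNb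
      _ = _ := by simp
  have hinv1 : ((N : ℝ) ^ b)⁻¹ ≤ 1 := inv_le_one_of_one_le₀ hNb1
  have hmem : q ∈ latticeBox d (2 ^ (M + 1) * N ^ (M + b + 1)) := by
    have hR : (2 : ℝ) ^ M * (N : ℝ) ^ (M + b + 1) + 1 ≤ 2 ^ (M + 1) * (N : ℝ) ^ (M + b + 1) := by
      have : (1 : ℝ) ≤ 2 ^ M * (N : ℝ) ^ (M + b + 1) :=
        one_le_mul_of_one_le_of_one_le (one_le_pow₀ (by norm_num)) (one_le_pow₀ hN1)
      rw [pow_succ 2]; linarith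
    have key : ∀ y : ℝ, |y| ≤ 2 ^ M * (N : ℝ) ^ (M + 1) →
        |⌊y * (N : ℝ) ^ b⌋| ≤ ((2 ^ (M + 1) * N ^ (M + b + 1) : ℕ) : ℤ) := by
      intro y hy
      have h1 := abs_floor_le (y * (N : ℝ) ^ b)
      rw [abs_mul, abs_of_pos hNb] at h1
      have h2 : |y| * (N : ℝ) ^ b ≤ 2 ^ M * (N : ℝ) ^ (M + b + 1) := by
        calc _ ≤ (2 ^ M * (N : ℝ) ^ (M + 1)) * (N : ℝ) ^ b := by gcongr
          _ = _ := by ring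
      have h3 : ((|⌊y * (N : ℝ) ^ b⌋| : ℤ) : ℝ) ≤
          (((2 ^ (M + 1) * N ^ (M + b + 1) : ℕ) : ℤ) : ℝ) := by
        push_cast at h1 ⊢
        linarith
      exact_mod_cast h3
    refine mem_latticeBox.2 ⟨key ω ?_, fun i => key (ξ i) ?_⟩
    · calc |ω| ≤ (1 + ‖ξ‖) ^ M := hω
        _ ≤ (2 * N) ^ M := by gcongr; linarith
        _ = 2 ^ M * (N : ℝ) ^ M := mul_pow _ _ _
        _ ≤ _ := by gcongr; omega
    · calc |ξ i| ≤ ‖ξ‖ := by simpa using PiLp.norm_apply_le ξ i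
        _ ≤ (N : ℝ) ^ 1 := by rw [pow_one]; exact hξN
        _ ≤ (N : ℝ) ^ (M + 1) := pow_le_pow_right₀ hN1 (by omega)
        _ ≤ _ := le_mul_of_one_le_left (by positivity) (one_le_pow₀ (by norm_num))
  have hshell : (N : ℝ) ≤ (1 + d) * (1 + ‖ξ'‖) := by
    have h1 : ‖ξ‖ ≤ ‖ξ'‖ + d := by
      have h2 := norm_sub_norm_le ξ ξ'
      have h3 : (d : ℝ) * ((N : ℝ) ^ b)⁻¹ ≤ d := mul_le_of_le_one_right d.cast_nonneg hinv1
      linarith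
    have : 0 ≤ (d : ℝ) * ‖ξ'‖ := by positivity
    linarith
  have hlat : ‖Yint w s t ω' ξ'‖ ≤ C₁ * (A * (N : ℝ) ^ α) * (t - s) ^ γ := by
    have hsub : ∀ r v, Yint w 0 v ω' ξ' - Yint w 0 r ω' ξ' = Yint w r v ω' ξ' := fun r v => by
      rw [← Yint_add hw 0 r v, add_sub_cancel_left]
    have h1 := hhol (fun v => Yint w 0 v ω' ξ') (A * (N : ℝ) ^ α)
      (intervalIntegral.continuous_primitive
        (fun a b => (continuous_Yker hw ω' ξ').intervalIntegrable a b) 0).continuousOn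
      (by positivity)
      (fun n k hk => by
        rw [hsub]
        exact hdy N (by omega) q hmem hshell n k hk) s t hs hst ht
    rwa [hsub] at h1
  have hts : 0 < t - s := by linarith
  have htsγ : t - s ≤ (t - s) ^ γ := by
    conv_lhs => rw [← Real.rpow_one (t - s)]
    exact Real.rpow_le_rpow_of_exponent_ge hts (by linarith) hγ1.le
  have hNα : ((N : ℝ) ^ b)⁻¹ ≤ (N : ℝ) ^ α := by
    rw [← Real.rpow_natCast, ← Real.rpow_neg hN0.le]
    exact Real.rpow_le_rpow_of_exponent_le hN1 (by linarith)
  have hNα' : (N : ℝ) ^ α ≤ 2 ^ (-α) * (1 + ‖ξ‖) ^ α := by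
    have h1 : (2 : ℝ) ^ (-α) = (2⁻¹ : ℝ) ^ α := by
      rw [Real.rpow_neg (by norm_num), Real.inv_rpow (by norm_num)]
    rw [h1, ← Real.mul_rpow (by norm_num) (by positivity)]
    exact Real.rpow_le_rpow_of_nonpos (by positivity) (by linarith) hα
  have hdiff : ‖Yint w s t ω ξ - Yint w s t ω' ξ'‖ ≤ (d * B + 1) * (N : ℝ) ^ α * (t - s) ^ γ := by
    refine (norm_Yint_sub_le hw hB hs hst.le ht ω ω' ξ ξ').trans ?_
    have h1 : ‖ξ - ξ'‖ * B + |ω - ω'| ≤ (d * B + 1) * (N : ℝ) ^ α := by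
      calc _ ≤ (d * ((N : ℝ) ^ b)⁻¹) * B + ((N : ℝ) ^ b)⁻¹ := by gcongr
        _ = (d * B + 1) * ((N : ℝ) ^ b)⁻¹ := by ring
        _ ≤ _ := by gcongr
    gcongr
  calc ‖Yint w s t ω ξ‖ ≤ ‖Yint w s t ω' ξ'‖ + ‖Yint w s t ω ξ - Yint w s t ω' ξ'‖ :=
        norm_le_insert' _ _
    _ ≤ C₁ * (A * (N : ℝ) ^ α) * (t - s) ^ γ + (d * B + 1) * (N : ℝ) ^ α * (t - s) ^ γ := by
        gcongr
    _ = (C₁ * A + (d * B + 1)) * (N : ℝ) ^ α * (t - s) ^ γ := by ring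
    _ ≤ (C₁ * A + (d * B + 1)) * (2 ^ (-α) * (1 + ‖ξ‖) ^ α) * (t - s) ^ γ := by gcongr
    _ = _ := by ring

lemma avgK_lt_top {d : ℕ} {w : ℝ → Euc d} {α β γ C : ℝ} (hβ : β ≤ α)
    (h : ∀ (s t ω : ℝ) (ξ : Euc d), 0 ≤ s → s < t → t ≤ 1 →
      ‖Yint w s t ω ξ‖ ≤ C * (1 + ‖ξ‖) ^ β * (t - s) ^ γ) : avgK w α γ < ⊤ := by
  refine lt_of_le_of_lt ?_ (ENNReal.ofReal_lt_top (r := C))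
  refine iSup_le fun s => iSup_le fun t => iSup_le fun hs => iSup_le fun hst => iSup_le fun ht =>
    iSup_le fun ω => iSup_le fun ξ => ENNReal.ofReal_le_ofReal ?_
  have hts : 0 < (t - s) ^ γ := Real.rpow_pos_of_pos (by linarith) γ
  have hx : 0 < (1 + ‖ξ‖) ^ α := by positivity
  have hlog := Real.sqrt_nonneg (Real.log (1 + |ω|))
  rw [div_le_iff₀ (by positivity)]
  have hY := h s t ω ξ hs hst ht
  have hxβ : 0 < (1 + ‖ξ‖) ^ β := by positivity
  have hC : 0 ≤ C := by
    have h1 := (norm_nonneg _).trans hY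
    by_contra! hC
    have h2 : C * (1 + ‖ξ‖) ^ β * (t - s) ^ γ < 0 :=
      mul_neg_of_neg_of_pos (mul_neg_of_neg_of_pos hC hxβ) hts
    linarith
  have h1 : (1 + ‖ξ‖) ^ β ≤ (1 + ‖ξ‖) ^ α :=
    Real.rpow_le_rpow_of_exponent_le (by linarith [norm_nonneg ξ]) hβ
  calc ‖Yint w s t ω ξ‖ ≤ C * (1 + ‖ξ‖) ^ β * (t - s) ^ γ := hY
    _ ≤ C * ((1 + ‖ξ‖) ^ α * 1) * (t - s) ^ γ := by rw [mul_one]; gcongr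
    _ ≤ C * ((1 + ‖ξ‖) ^ α * (1 + Real.sqrt (Real.log (1 + |ω|)))) * (t - s) ^ γ := by
        gcongr; linarith
    _ = _ := by ring

lemma IsFBM.exists_ae_avgK_lt_top {Ω : Type*} [MeasureSpace Ω]
    [IsProbabilityMeasure (volume : Measure Ω)] {d : ℕ} {H : ℝ} (hH : 0 < H) (hH1 : H < 1)
    {W : Ω → ℝ → Euc d} (hW : IsFBM d H W) (hc : ∀ x, Continuous (W x)) {α : ℝ}
    (hα : -1 / (2 * H) < α) : ∃ γ : ℝ, 1 / 2 < γ ∧ ∀ᵐ x : Ω, avgK (W x) α γ < ⊤ := by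
  set β := min α 0 with hβ
  have hβ0 : β ≤ 0 := min_le_right _ _
  have hβH : 0 < 1 / H + 2 * β := by
    have h1 : -1 / (2 * H) < β := lt_min hα (div_neg_of_neg_of_pos (by norm_num) (by positivity))
    have h2 : -1 / (2 * H) = -(1 / H) / 2 := by field_simp
    linarith
  obtain ⟨L, hL⟩ := exists_nat_gt ((1 - β) / (1 / H + 2 * β))
  have hL0 : 0 < L := by
    have : (0 : ℝ) < L := lt_of_le_of_lt (div_nonneg (by linarith) hβH.le) hL
    exact_mod_cast this
  have hLβ : 1 ≤ L * (1 / H + 2 * β) + β := by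
    rw [div_lt_iff₀ hβH] at hL; linarith
  set γ : ℝ := (L + 3 / 4 : ℝ) / (2 * L + 1) with hγ
  have hL' : (1 : ℝ) ≤ L := by exact_mod_cast hL0
  have hγ2 : 1 / 2 < γ := by rw [hγ, lt_div_iff₀ (by positivity)]; linarith
  have hγ1 : γ < 1 := by rw [hγ, div_lt_one (by positivity)]; linarith
  refine ⟨γ, hγ2, ?_⟩
  have hh : 0 < H / 2 := half_pos hH
  obtain ⟨M, hM⟩ := exists_nat_gt ((-β / (1 - γ) + 1) / (H / 2))
  have hMβ : -β ≤ ((M : ℝ) * (H / 2) - 1) * (1 - γ) := by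
    rw [div_lt_iff₀ hh] at hM
    exact (div_le_iff₀ (by linarith)).1 (by linarith)
  obtain ⟨b, hb⟩ := exists_nat_gt (-β)
  filter_upwards [hW.ae_holder hH, ae_dyadic_lattice_bound hH hH1 hW hc hL0 hLβ b
    (2 ^ (M + 1)) (M + b + 1) Nat.one_le_two_pow] with x ⟨A, hA, hhol⟩ ⟨A', hA', hdy⟩
  obtain ⟨C, hC, hsmall⟩ := exists_norm_Yint_le_of_small_frequency (hc x) hβ0 (by linarith) hγ1
    hA' hb.le hdy
  have hC' : 0 ≤ ((1 + A) * Real.pi ^ (H / 2)) ^ (1 - γ) := by positivity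
  refine avgK_lt_top (β := β) (C := C + ((1 + A) * Real.pi ^ (H / 2)) ^ (1 - γ))
    (min_le_left _ _) fun s t ω ξ hs hst ht => ?_
  have hts : 0 < (t - s) ^ γ := Real.rpow_pos_of_pos (by linarith) γ
  rcases le_total |ω| ((1 + ‖ξ‖) ^ M) with h | h
  · refine (hsmall s t ω ξ hs hst ht h).trans ?_
    gcongr
    linarith
  · rw [← Real.rpow_natCast] at h
    refine (norm_Yint_le_of_large_frequency (hc x) hA hh (by linarith) hhol (by linarith) hγ1
      hMβ hs hst ht ξ h).trans ?_
    gcongr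
    linarith

lemma avgK_congr {d : ℕ} {w w' : ℝ → Euc d} (h : ∀ u ∈ Set.Icc (0 : ℝ) 1, w u = w' u) (α γ : ℝ) :
    avgK w α γ = avgK w' α γ := by
  unfold avgK
  refine iSup_congr fun s => iSup_congr fun t => iSup_congr fun hs => iSup_congr fun hst =>
    iSup_congr fun ht => iSup_congr fun ω => iSup_congr fun ξ => ?_
  have : Yint w s t ω ξ = Yint w' s t ω ξ := by
    refine intervalIntegral.integral_congr fun u hu => ?_
    rw [Set.uIcc_of_le hst.le] at hu
    simp only [h u ⟨hs.trans hu.1, hu.2.trans ht⟩]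
  rw [this]

/-- For a `d`-dimensional fBm of Hurst index `H ∈ (0,1)` and any
`α > −1/(2H)` there is `γ > 1/2` such that almost surely `K^W_{α,γ} < ∞`. -/
theorem statement16 {Ω : Type*} [MeasureSpace Ω] [IsProbabilityMeasure (volume : Measure Ω)]
    (d : ℕ) (hd : 0 < d) (H : ℝ) (hH : 0 < H) (hH1 : H < 1)
    (W : Ω → ℝ → Euc d) (hW : IsFBM d H W) (α : ℝ) (hα : -1 / (2 * H) < α) :
    ∃ γ : ℝ, 1 / 2 < γ ∧ ∀ᵐ ω : Ω, avgK (W ω) α γ < ⊤ := by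
  let P : ℝ → ℝ := fun u => Set.projIcc (0 : ℝ) 1 zero_le_one u
  have hP : ∀ u ∈ Set.Icc (0 : ℝ) 1, P u = u := fun u hu => by
    simp only [P, Set.projIcc_of_mem _ hu]
  have hPm : ∀ u, P u ∈ Set.Icc (0 : ℝ) 1 := fun u => (Set.projIcc (0 : ℝ) 1 zero_le_one u).2
  have hW' : IsFBM d H fun x u => W x (P u) := by
    refine ⟨fun x => ?_, fun t => hW.2.1 _, fun x => ?_, fun n c t j ht => ?_⟩
    · exact (hW.1 x).congr fun u hu => by simp only [hP u hu]
    · simp only [hP 0 (by simp), hW.2.2.1 x]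
    · simp only [fun k => hP (t k) (ht k)]
      exact hW.2.2.2 n c t j ht
  have hc : ∀ x, Continuous fun u => W x (P u) := fun x =>
    (hW.1 x).comp_continuous (continuous_subtype_val.comp continuous_projIcc) hPm
  obtain ⟨γ, hγ, hae⟩ := hW'.exists_ae_avgK_lt_top hH hH1 hc hα
  refine ⟨γ, hγ, ?_⟩
  filter_upwards [hae] with x hx
  rwa [avgK_congr (w' := W x) fun u hu => by rw [hP u hu]] at hx
end
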